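/- arXiv:2602.08016 — 7 statements merged into one kernel-verified Lean document; each statement's English description precedes it below -/
import Mathlib

section
/- Let (V, g, p) be a d-dimensional geometric constraint system: g : (ℝ^d)^n → ℝ^m has polynomial components invariant under Euclidean isometries of ℝ^d, and g(p) = 0. If every infinitesimal flex of the system is trivial (i.e., the system is infinitesimally rigid), then the system is rigid: there exists a neighborhood U of p in (ℝ^d)^n such that every q ∈ U with g(q) = 0 is congruent to p, meaning ‖p_i − p_j‖ = ‖q_i − q_j‖ for all i, j ∈ {1,…,n}. -/
open scoped BigOperators Matrix

/-- Functions given by evaluating a real polynomial are differentiable. -/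
theorem MvPolynomial.differentiable_eval_uncurry {ι κ : Type*} [Fintype ι] [Fintype κ]
    (P : MvPolynomial (ι × κ) ℝ) :
    Differentiable ℝ fun x : ι → κ → ℝ => MvPolynomial.eval (fun v => x v.1 v.2) P := by
  induction P using MvPolynomial.induction_on with
  | C a => simp
  | add P Q hP hQ => simpa only [map_add] using! hP.add hQ
  | mul_X P v hP =>
    have hv : Differentiable ℝ fun x : ι → κ → ℝ => x v.1 v.2 := by fun_prop
    simpa only [map_mul, MvPolynomial.eval_X] using! hP.mul hv

/-- If the derivative of `g` at `p` is injective on a finite-dimensional subspace `L`, then `p` is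
isolated in its fibre within `p + L`. -/
theorem HasFDerivAt.eventually_eq_zero_of_injOn {E F : Type*} [NormedAddCommGroup E]
    [NormedSpace ℝ E] [NormedAddCommGroup F] [NormedSpace ℝ F] {g : E → F} {g' : E →L[ℝ] F} {p : E}
    (hg : HasFDerivAt g g' p) (L : Submodule ℝ E) [FiniteDimensional ℝ L]
    (hL : ∀ w ∈ L, g' w = 0 → w = 0) :
    ∃ ε > 0, ∀ w ∈ L, ‖w‖ < ε → g (p + w) = g p → w = 0 := by
  have hG : HasFDerivAt (fun w : L => g (p + w)) (g'.comp L.subtypeL) 0 := by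
    have h1 : HasFDerivAt (fun w : L => p + (w : E)) L.subtypeL 0 :=
      L.subtypeL.hasFDerivAt.const_add p
    have h2 : HasFDerivAt g g' (p + ((0 : L) : E)) := by simpa using hg
    exact h2.comp (0 : L) h1
  have hker : LinearMap.ker (g'.comp L.subtypeL).toLinearMap = ⊥ := by
    rw [LinearMap.ker_eq_bot']
    intro w hw
    exact Subtype.ext (hL w w.2 hw)
  obtain ⟨K, -, hK⟩ := LinearMap.exists_antilipschitzWith _ hker
  have hev := hG.eventually_ne (c := g p) ⟨K, hK⟩
  rw [eventually_nhdsWithin_iff, Metric.eventually_nhds_iff] at hev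
  obtain ⟨ε, hε, h⟩ := hev
  refine ⟨ε, hε, fun w hw hwε hgw => ?_⟩
  by_contra hne
  exact h (y := ⟨w, hw⟩) (by simpa using hwε) (by simpa using hne) hgw

/-- The set of orthogonal matrices is compact. -/
theorem Matrix.isCompact_setOf_transpose_mul_self_eq_one (ι : Type*) [Fintype ι] [DecidableEq ι] :
    IsCompact {Q : Matrix ι ι ℝ | Qᵀ * Q = 1} := by
  have hbox : IsCompact (Set.univ.pi fun _ : ι => Set.univ.pi fun _ : ι => Set.Icc (-1 : ℝ) 1) :=
    isCompact_univ_pi fun _ => isCompact_univ_pi fun _ => isCompact_Icc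
  refine IsCompact.of_isClosed_subset hbox ?_ ?_
  · exact isClosed_eq (by fun_prop) continuous_const
  · intro Q hQ i _ j _
    have h : ∑ k, Q k j * Q k j = 1 := by
      simpa [Matrix.mul_apply] using congrFun (congrFun hQ j) j
    have h2 : Q i j * Q i j ≤ 1 := h ▸ Finset.single_le_sum (f := fun k => Q k j * Q k j)
      (fun k _ => mul_self_nonneg _) (Finset.mem_univ i)
    exact ⟨by nlinarith, by nlinarith⟩

section

attribute [local instance] Matrix.linftyOpNormedRing Matrix.linftyOpNormedAlgebra

/-- A linear functional on matrices that is maximized over the orthogonal group at `Q` vanishes on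
the tangent space `{S * Q | S skew}`. -/
theorem Matrix.eq_zero_of_isMaxOn_orthogonal {ι : Type*} [Fintype ι] [DecidableEq ι]
    (h : Matrix ι ι ℝ →ₗ[ℝ] ℝ) {Q : Matrix ι ι ℝ} (hQ : Qᵀ * Q = 1)
    (hmax : IsMaxOn h {Q | Qᵀ * Q = 1} Q) {S : Matrix ι ι ℝ} (hS : Sᵀ = -S) :
    h (S * Q) = 0 := by
  let H : Matrix ι ι ℝ →L[ℝ] ℝ :=
    LinearMap.toContinuousLinearMap (h ∘ₗ LinearMap.mulRight ℝ Q)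
  have hd : HasDerivAt (fun t : ℝ => H (NormedSpace.exp (t • S))) (H S) 0 := by
    have h1 : HasDerivAt (fun t : ℝ => NormedSpace.exp (t • S)) S 0 := by
      simpa using! hasDerivAt_exp_smul_const (𝕂 := ℝ) S (0 : ℝ)
    exact H.hasFDerivAt.comp_hasDerivAt 0 h1
  have hloc : IsLocalMax (fun t : ℝ => H (NormedSpace.exp (t • S))) 0 := by
    refine Filter.Eventually.of_forall fun t => ?_
    have hE : (NormedSpace.exp (t • S))ᵀ * NormedSpace.exp (t • S) = 1 := by
      rw [← Matrix.exp_transpose, Matrix.transpose_smul, hS, smul_neg,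
        ← Matrix.exp_add_of_commute _ _ (Commute.refl (t • S)).neg_left]
      simp
    have : (NormedSpace.exp (t • S) * Q)ᵀ * (NormedSpace.exp (t • S) * Q) = 1 := by
      rw [Matrix.transpose_mul, Matrix.mul_assoc, ← Matrix.mul_assoc _ _ Q, hE, Matrix.one_mul, hQ]
    simpa [H] using hmax this
  exact hloc.hasDerivAt_eq_zero hd

end

theorem Matrix.mulVec_dotProduct_mulVec_of_transpose_mul_self_eq_one {ι : Type*} [Fintype ι]
    [DecidableEq ι] {Q : Matrix ι ι ℝ} (hQ : Qᵀ * Q = 1) (x y : ι → ℝ) :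
    Q *ᵥ x ⬝ᵥ Q *ᵥ y = x ⬝ᵥ y := by
  rw [Matrix.dotProduct_mulVec, Matrix.vecMul_mulVec, hQ, Matrix.vecMul_one]

theorem Matrix.dotProduct_mulVec_of_transpose_eq_neg {ι : Type*} [Fintype ι]
    {S : Matrix ι ι ℝ} (hS : Sᵀ = -S) (x y : ι → ℝ) :
    x ⬝ᵥ S *ᵥ y = -(y ⬝ᵥ S *ᵥ x) := by
  rw [Matrix.dotProduct_mulVec, ← Matrix.mulVec_transpose, hS, Matrix.neg_mulVec,
    neg_dotProduct, dotProduct_comm]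

/-- Orthogonal Procrustes alignment: `a` can be rotated to `Q a` so that the residual `Q a - b` is
no larger than `a - b` and is orthogonal to all infinitesimal rotations of `b`. -/
theorem Matrix.exists_orthogonal_alignment {ι κ : Type*} [Fintype ι] [Fintype κ] [DecidableEq κ]
    (a b : ι → κ → ℝ) :
    ∃ Q : Matrix κ κ ℝ, Qᵀ * Q = 1 ∧
      (∀ S : Matrix κ κ ℝ, Sᵀ = -S → ∑ i, (Q *ᵥ a i - b i) ⬝ᵥ S *ᵥ b i = 0) ∧
      ∑ i, (Q *ᵥ a i - b i) ⬝ᵥ (Q *ᵥ a i - b i) ≤ ∑ i, (a i - b i) ⬝ᵥ (a i - b i) := by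
  let h : Matrix κ κ ℝ →ₗ[ℝ] ℝ :=
    { toFun := fun Q => ∑ i, b i ⬝ᵥ Q *ᵥ a i
      map_add' := fun Q R => by simp [Matrix.add_mulVec, Finset.sum_add_distrib]
      map_smul' := fun c Q => by simp [Matrix.smul_mulVec, Finset.mul_sum] }
  have hcont : Continuous h := h.continuous_of_finiteDimensional
  obtain ⟨Q, hQ, hmax⟩ := (Matrix.isCompact_setOf_transpose_mul_self_eq_one κ).exists_isMaxOn
    ⟨1, by simp⟩ hcont.continuousOn
  refine ⟨Q, hQ, fun S hS => ?_, ?_⟩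
  · have h0 : ∑ i, b i ⬝ᵥ (S * Q) *ᵥ a i = 0 := Matrix.eq_zero_of_isMaxOn_orthogonal h hQ hmax hS
    rw [← neg_eq_zero, ← Finset.sum_neg_distrib, ← h0]
    refine Finset.sum_congr rfl fun i _ => ?_
    have hb : b i ⬝ᵥ S *ᵥ b i = 0 := by
      have := Matrix.dotProduct_mulVec_of_transpose_eq_neg hS (b i) (b i)
      linarith
    rw [sub_dotProduct, hb, sub_zero, ← Matrix.dotProduct_mulVec_of_transpose_eq_neg hS,
      Matrix.mulVec_mulVec]
  · have h1 : ∑ i, b i ⬝ᵥ a i ≤ ∑ i, b i ⬝ᵥ Q *ᵥ a i := by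
      simpa [h] using hmax (show (1 : Matrix κ κ ℝ) ∈ {Q : Matrix κ κ ℝ | Qᵀ * Q = 1} by simp)
    have expand (x y : κ → ℝ) : (x - y) ⬝ᵥ (x - y) = x ⬝ᵥ x + y ⬝ᵥ y - 2 * (y ⬝ᵥ x) := by
      rw [sub_dotProduct, dotProduct_sub, dotProduct_sub, dotProduct_comm x y]
      ring
    simp only [expand, Matrix.mulVec_dotProduct_mulVec_of_transpose_mul_self_eq_one hQ,
      Finset.sum_sub_distrib, ← Finset.mul_sum]
    linarith

/-- The normal slice at `p` pinned at the vertex `i₀`: displacements fixing `i₀` and orthogonal to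
all infinitesimal rotations of `p` about `p i₀`. -/
def pinnedSlice {ι κ : Type*} [Fintype ι] [Fintype κ] (p : ι → κ → ℝ) (i₀ : ι) :
    Submodule ℝ (ι → κ → ℝ) where
  carrier := {w | w i₀ = 0 ∧ ∀ S : Matrix κ κ ℝ, Sᵀ = -S →
    ∑ i, w i ⬝ᵥ S *ᵥ (p i - p i₀) = 0}
  zero_mem' := by simp
  add_mem' := by
    rintro v w ⟨hv, hv'⟩ ⟨hw, hw'⟩
    refine ⟨by simp [hv, hw], fun S hS => ?_⟩
    simp [add_dotProduct, Finset.sum_add_distrib, hv' S hS, hw' S hS]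
  smul_mem' := by
    rintro c v ⟨hv, hv'⟩
    refine ⟨by simp [hv], fun S hS => ?_⟩
    simp [smul_dotProduct, ← Finset.mul_sum, hv' S hS]

theorem eq_zero_of_mem_pinnedSlice {ι κ : Type*} [Fintype ι] [Fintype κ] {p : ι → κ → ℝ} {i₀ : ι}
    {w : ι → κ → ℝ} (hw : w ∈ pinnedSlice p i₀)
    (htriv : ∃ (S : Matrix κ κ ℝ) (τ : κ → ℝ), Sᵀ = -S ∧ ∀ i, w i = S *ᵥ p i + τ) : w = 0 := by
  obtain ⟨h0, horth⟩ := hw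
  obtain ⟨S, τ, hS, hwS⟩ := htriv
  have hrot (i : ι) : S *ᵥ (p i - p i₀) = w i := by
    rw [Matrix.mulVec_sub, ← sub_zero (w i), ← h0, hwS i, hwS i₀]
    abel
  have hsum := horth S hS
  simp only [hrot] at hsum
  have hnonneg (i : ι) : 0 ≤ w i ⬝ᵥ w i := Finset.sum_nonneg fun k _ => mul_self_nonneg (w i k)
  rw [Finset.sum_eq_zero_iff_of_nonneg fun i _ => hnonneg i] at hsum
  exact funext fun i => dotProduct_self_eq_zero.1 (hsum i (Finset.mem_univ i))

theorem norm_lt_of_sum_dotProduct_self_lt {ι κ : Type*} [Fintype ι] [Fintype κ] {w : ι → κ → ℝ}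
    {ε : ℝ} (hε : 0 < ε) (h : ∑ i, w i ⬝ᵥ w i < ε ^ 2) : ‖w‖ < ε := by
  refine (pi_norm_lt_iff hε).2 fun i => (pi_norm_lt_iff hε).2 fun k => ?_
  have h1 : w i ⬝ᵥ w i ≤ ∑ i, w i ⬝ᵥ w i :=
    Finset.single_le_sum (f := fun i => w i ⬝ᵥ w i)
      (fun i _ => Finset.sum_nonneg fun k _ => mul_self_nonneg (w i k)) (Finset.mem_univ i)
  have h2 : w i k * w i k ≤ w i ⬝ᵥ w i :=
    Finset.single_le_sum (f := fun k => w i k * w i k)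
      (fun k _ => mul_self_nonneg (w i k)) (Finset.mem_univ k)
  exact abs_lt_of_sq_lt_sq (by nlinarith) hε.le

/-- For a `d`-dimensional geometric constraint system `(V, g, p)`
(with `g : (ℝ^d)^n → ℝ^m` polynomial and invariant under Euclidean isometries, `g p = 0`),
infinitesimal rigidity implies rigidity: there is a neighborhood `U` of `p` such that
every realization `q ∈ U` (i.e. `g q = 0`) is congruent to `p`. -/
theorem infinitesimal_rigidity_implies_rigidity
    (d n m : ℕ)
    (g : (Fin n → Fin d → ℝ) → Fin m → ℝ)
    -- the components of g are polynomials
    (hpoly : ∃ P : Fin m → MvPolynomial (Fin n × Fin d) ℝ,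
      ∀ (x : Fin n → Fin d → ℝ) (i : Fin m),
        g x i = MvPolynomial.eval (fun v => x v.1 v.2) (P i))
    -- g is invariant under Euclidean isometries of ℝ^d
    (hinv : ∀ (Q : Matrix (Fin d) (Fin d) ℝ), Qᵀ * Q = 1 → ∀ (τ : Fin d → ℝ),
      ∀ x : Fin n → Fin d → ℝ, g (fun i => Q.mulVec (x i) + τ) = g x)
    -- p is a realization
    (p : Fin n → Fin d → ℝ) (hp : g p = 0)
    -- infinitesimal rigidity: every infinitesimal flex is trivial
    (hinfrig : ∀ v : Fin n → Fin d → ℝ, fderiv ℝ g p v = 0 →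
      ∃ (S : Matrix (Fin d) (Fin d) ℝ) (τ : Fin d → ℝ),
        Sᵀ = -S ∧ ∀ i, v i = S.mulVec (p i) + τ) :
    -- rigidity
    ∃ U : Set (Fin n → Fin d → ℝ), IsOpen U ∧ p ∈ U ∧
      ∀ q ∈ U, g q = 0 →
        ∀ i j : Fin n,
          Real.sqrt (∑ k, (p i k - p j k) ^ 2) = Real.sqrt (∑ k, (q i k - q j k) ^ 2) := by
  rcases isEmpty_or_nonempty (Fin n) with _ | ⟨⟨i₀⟩⟩
  · exact ⟨Set.univ, isOpen_univ, trivial, fun q _ _ i => isEmptyElim i⟩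
  obtain ⟨P, hP⟩ := hpoly
  have hdiff : DifferentiableAt ℝ g p := by
    refine differentiableAt_pi.2 fun i => ?_
    simp only [hP]
    exact (MvPolynomial.differentiable_eval_uncurry (P i)) p
  obtain ⟨ε, hε, hiso⟩ := hdiff.hasFDerivAt.eventually_eq_zero_of_injOn (pinnedSlice p i₀)
    fun w hw hgw => eq_zero_of_mem_pinnedSlice hw (hinfrig w hgw)
  refine ⟨{q | ∑ i, ((q i - q i₀) - (p i - p i₀)) ⬝ᵥ ((q i - q i₀) - (p i - p i₀)) < ε ^ 2},
    isOpen_lt (by unfold dotProduct; fun_prop) continuous_const, by simpa using pow_pos hε 2,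
    fun q hq hgq i j => ?_⟩
  obtain ⟨Q, hQ, horth, hle⟩ := Matrix.exists_orthogonal_alignment
    (fun i => q i - q i₀) (fun i => p i - p i₀)
  have hw := hiso (fun i => Q *ᵥ (q i - q i₀) - (p i - p i₀)) ⟨by simp, horth⟩
    (norm_lt_of_sum_dotProduct_self_lt hε (hle.trans_lt hq)) (by
      rw [hp, ← hgq, ← hinv Q hQ (p i₀ - Q *ᵥ q i₀) q]
      congr 1
      funext i
      simp only [Pi.add_apply, Matrix.mulVec_sub]
      abel)
  have hcong : p i - p j = Q *ᵥ (q i - q j) := by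
    have hi : p i - p i₀ = Q *ᵥ (q i - q i₀) := (sub_eq_zero.1 (congrFun hw i)).symm
    have hj : p j - p i₀ = Q *ᵥ (q j - q i₀) := (sub_eq_zero.1 (congrFun hw j)).symm
    rw [← sub_sub_sub_cancel_right (p i) (p j) (p i₀), hi, hj, ← Matrix.mulVec_sub,
      sub_sub_sub_cancel_right]
  have hdot := Matrix.mulVec_dotProduct_mulVec_of_transpose_mul_self_eq_one hQ
    (q i - q j) (q i - q j)
  rw [← hcong] at hdot
  simpa [dotProduct, sq] using congrArg Real.sqrt hdot
end

section
/- Let p_1, …, p_n ∈ ℝ^d and let ℓ be the dimension of the affine span of {p_1,…,p_n}. Then the linear subspace of (ℝ^d)^n consisting of all vectors v with v_i = S·p_i + τ for some skew-symmetric matrix S ∈ ℝ^{d×d} and some τ ∈ ℝ^d (the space of trivial infinitesimal flexes) has dimension (ℓ+1)(2d−ℓ)/2. -/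
open scoped BigOperators Matrix

/-- The space of skew-symmetric real `m × m` matrices. -/
def skewMatrices (m : ℕ) : Submodule ℝ (Matrix (Fin m) (Fin m) ℝ) where
  carrier := {S | Sᵀ = -S}
  add_mem' {A B} hA hB := by
    simp only [Set.mem_ofPred_eq] at *
    rw [Matrix.transpose_add, hA, hB, neg_add]
  zero_mem' := by simp
  smul_mem' c A hA := by
    simp only [Set.mem_ofPred_eq] at *
    rw [Matrix.transpose_smul, hA, smul_neg]

theorem mem_skewMatrices {m : ℕ} {S : Matrix (Fin m) (Fin m) ℝ} :
    S ∈ skewMatrices m ↔ Sᵀ = -S := Iff.rfl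

/-- A skew-symmetric matrix is determined by its entries strictly above the diagonal. -/
def skewMatricesEquivUpper (m : ℕ) :
    skewMatrices m ≃ₗ[ℝ] ((j : Fin m) → Fin (j : ℕ) → ℝ) where
  toFun S j i := S.1 (i.castLE j.2.le) j
  map_add' _ _ := rfl
  map_smul' _ _ := rfl
  invFun f := ⟨Matrix.of fun i j =>
      if h : (i : ℕ) < j then f j ⟨i, h⟩ else if h : (j : ℕ) < i then -f i ⟨j, h⟩ else 0, by
    rw [mem_skewMatrices]
    ext i j
    rcases lt_trichotomy i j with h | h | h
    · simp [Matrix.transpose_apply, h, h.not_gt]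
    · simp [Matrix.transpose_apply, h]
    · simp [Matrix.transpose_apply, h, h.not_gt]⟩
  left_inv S := by
    have hS : ∀ i j, S.1 j i = -S.1 i j := fun i j =>
      congrFun (congrFun (mem_skewMatrices.1 S.2) i) j
    ext i j
    rcases lt_trichotomy i j with h | h | h
    · simp [h]
    · subst h
      have := hS i i
      simp
      linarith
    · simp [h, h.not_gt, hS i j]
  right_inv f := by
    funext j i
    exact dif_pos i.2

theorem finrank_skewMatrices_mul_two (m : ℕ) :
    Module.finrank ℝ (skewMatrices m) * 2 = m * (m - 1) := by
  rw [(skewMatricesEquivUpper m).finrank_eq, Module.finrank_pi_fintype]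
  simp only [Module.finrank_fin_fun]
  rw [Fin.sum_univ_eq_sum_range (fun i => i), Finset.sum_range_id_mul_two]

/-- The space of skew-symmetric matrices whose kernel contains `W`. -/
def skewMatricesVanishingOn {d : ℕ} (W : Submodule ℝ (Fin d → ℝ)) :
    Submodule ℝ (Matrix (Fin d) (Fin d) ℝ) where
  carrier := {S | Sᵀ = -S ∧ ∀ w ∈ W, S *ᵥ w = 0}
  add_mem' {A B} hA hB :=
    ⟨(skewMatrices d).add_mem hA.1 hB.1, fun w hw => by
      rw [Matrix.add_mulVec, hA.2 w hw, hB.2 w hw, add_zero]⟩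
  zero_mem' := ⟨(skewMatrices d).zero_mem, fun w _ => Matrix.zero_mulVec w⟩
  smul_mem' c A hA :=
    ⟨(skewMatrices d).smul_mem c hA.1, fun w hw => by
      rw [Matrix.smul_mulVec, hA.2 w hw, smul_zero]⟩

theorem mem_skewMatricesVanishingOn {d : ℕ} {W : Submodule ℝ (Fin d → ℝ)}
    {S : Matrix (Fin d) (Fin d) ℝ} :
    S ∈ skewMatricesVanishingOn W ↔ Sᵀ = -S ∧ ∀ w ∈ W, S *ᵥ w = 0 := Iff.rfl

/-- Every subspace is the kernel of a matrix with a right inverse. -/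
theorem exists_matrix_ker_eq {d : ℕ} (W : Submodule ℝ (Fin d → ℝ)) :
    ∃ (P : Matrix (Fin (d - Module.finrank ℝ W)) (Fin d) ℝ)
      (Q : Matrix (Fin d) (Fin (d - Module.finrank ℝ W)) ℝ),
      P * Q = 1 ∧ ∀ w, w ∈ W ↔ P *ᵥ w = 0 := by
  have hquot : Module.finrank ℝ ((Fin d → ℝ) ⧸ W) =
      Module.finrank ℝ (Fin (d - Module.finrank ℝ W) → ℝ) := by
    rw [Submodule.finrank_quotient, Module.finrank_fin_fun, Module.finrank_fin_fun]
  let e := LinearEquiv.ofFinrankEq _ _ hquot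
  let π : (Fin d → ℝ) →ₗ[ℝ] (Fin (d - Module.finrank ℝ W) → ℝ) := e.toLinearMap ∘ₗ W.mkQ
  have hπ : Function.Surjective π := e.surjective.comp W.mkQ_surjective
  obtain ⟨σ, hσ⟩ := π.exists_rightInverse_of_surjective (LinearMap.range_eq_top.2 hπ)
  refine ⟨LinearMap.toMatrix' π, LinearMap.toMatrix' σ, ?_, fun w => ?_⟩
  · rw [← LinearMap.toMatrix'_comp, hσ, LinearMap.toMatrix'_id]
  · rw [LinearMap.toMatrix'_mulVec]
    simp [π]

theorem finrank_skewMatricesVanishingOn {d : ℕ} (W : Submodule ℝ (Fin d → ℝ)) :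
    Module.finrank ℝ (skewMatricesVanishingOn W) =
      Module.finrank ℝ (skewMatrices (d - Module.finrank ℝ W)) := by
  obtain ⟨P, Q, hPQ, hW⟩ := exists_matrix_ker_eq W
  have hQP : Qᵀ * Pᵀ = 1 := by rw [← Matrix.transpose_mul, hPQ, Matrix.transpose_one]
  have hS : ∀ S ∈ skewMatricesVanishingOn W, S * (Q * P) = S := by
    intro S hS
    refine Matrix.ext_of_mulVec_single fun i => ?_
    have hmem : (Q * P) *ᵥ Pi.single i 1 - Pi.single i 1 ∈ W := by
      rw [hW, Matrix.mulVec_sub, Matrix.mulVec_mulVec, ← Matrix.mul_assoc, hPQ, Matrix.one_mul,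
        sub_self]
    have := hS.2 _ hmem
    rwa [Matrix.mulVec_sub, Matrix.mulVec_mulVec, sub_eq_zero] at this
  have hS' : ∀ S ∈ skewMatricesVanishingOn W, Pᵀ * Qᵀ * S = S := by
    intro S h
    have := congrArg Matrix.transpose (hS S h)
    rw [Matrix.transpose_mul, Matrix.transpose_mul, h.1, Matrix.mul_neg] at this
    exact neg_injective this
  have hT : ∀ T ∈ skewMatrices (d - Module.finrank ℝ W),
      Pᵀ * T * P ∈ skewMatricesVanishingOn W := by
    refine fun T hT => ⟨?_, fun w hw => ?_⟩
    · simp [Matrix.transpose_mul, mem_skewMatrices.1 hT, Matrix.mul_assoc]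
    · rw [← Matrix.mulVec_mulVec, (hW w).1 hw, Matrix.mulVec_zero]
  have hQ : ∀ S ∈ skewMatricesVanishingOn W,
      Qᵀ * S * Q ∈ skewMatrices (d - Module.finrank ℝ W) := by
    intro S h
    rw [mem_skewMatrices]
    simp [Matrix.transpose_mul, h.1, Matrix.mul_assoc]
  refine LinearEquiv.finrank_eq (R := ℝ)
    { toFun := fun S => ⟨Qᵀ * S.1 * Q, hQ _ S.2⟩
      map_add' := fun A B => Subtype.ext (by simp [Matrix.mul_add, Matrix.add_mul])
      map_smul' := fun c A => Subtype.ext (by simp)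
      invFun := fun T => ⟨Pᵀ * T.1 * P, hT _ T.2⟩
      left_inv := fun S => Subtype.ext ?_
      right_inv := fun T => Subtype.ext ?_ }
  · calc Pᵀ * (Qᵀ * S.1 * Q) * P = Pᵀ * Qᵀ * (S.1 * (Q * P)) := by simp only [Matrix.mul_assoc]
      _ = S.1 := by rw [hS _ S.2, hS' _ S.2]
  · calc Qᵀ * (Pᵀ * T.1 * P) * Q = (Qᵀ * Pᵀ) * T.1 * (P * Q) := by simp only [Matrix.mul_assoc]
      _ = T.1 := by rw [hQP, hPQ, Matrix.one_mul, Matrix.mul_one]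

/-- The linear map sending `(S, τ)` to the trivial infinitesimal flex `i ↦ S p i + τ`. -/
def trivialFlexMap {d n : ℕ} (p : Fin n → Fin d → ℝ) :
    skewMatrices d × (Fin d → ℝ) →ₗ[ℝ] (Fin n → Fin d → ℝ) where
  toFun x i := x.1.1 *ᵥ p i + x.2
  map_add' x y := by
    funext i
    simp only [Prod.fst_add, Prod.snd_add, Submodule.coe_add, Matrix.add_mulVec, Pi.add_apply]
    abel
  map_smul' c x := by
    funext i
    simp [Matrix.smul_mulVec]

theorem span_trivialFlexes_eq_range {d n : ℕ} (p : Fin n → Fin d → ℝ) :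
    Submodule.span ℝ
      {v : Fin n → Fin d → ℝ | ∃ (S : Matrix (Fin d) (Fin d) ℝ) (τ : Fin d → ℝ),
        Sᵀ = -S ∧ ∀ i, v i = S.mulVec (p i) + τ} = LinearMap.range (trivialFlexMap p) := by
  rw [← Submodule.span_eq (LinearMap.range (trivialFlexMap p))]
  congr 1
  ext v
  constructor
  · rintro ⟨S, τ, hS, hv⟩
    exact ⟨(⟨S, hS⟩, τ), funext fun i => (hv i).symm⟩
  · rintro ⟨⟨S, τ⟩, rfl⟩
    exact ⟨S.1, τ, S.2, fun i => rfl⟩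

theorem mulVec_eq_zero_on_vectorSpan {d n : ℕ} (p : Fin n → Fin d → ℝ) (i₀ : Fin n)
    (S : Matrix (Fin d) (Fin d) ℝ) :
    (∀ w ∈ vectorSpan ℝ (Set.range p), S *ᵥ w = 0) ↔ ∀ i, S *ᵥ p i = S *ᵥ p i₀ := by
  have h : (∀ w ∈ vectorSpan ℝ (Set.range p), S *ᵥ w = 0) ↔
      vectorSpan ℝ (Set.range p) ≤ LinearMap.ker S.mulVecLin := Iff.rfl
  rw [h, vectorSpan_range_eq_span_range_vsub_right ℝ p i₀, Submodule.span_le,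
    Set.range_subset_iff]
  simp [Matrix.mulVec_sub, sub_eq_zero]

theorem finrank_ker_trivialFlexMap {d n : ℕ} (p : Fin n → Fin d → ℝ) (i₀ : Fin n) :
    Module.finrank ℝ (LinearMap.ker (trivialFlexMap p)) =
      Module.finrank ℝ (skewMatricesVanishingOn (vectorSpan ℝ (Set.range p))) := by
  refine LinearEquiv.finrank_eq (R := ℝ)
    { toFun := fun x => ⟨x.1.1.1, x.1.1.2, ?_⟩
      map_add' := fun _ _ => rfl
      map_smul' := fun _ _ => rfl
      invFun := fun S => ⟨(⟨S.1, S.2.1⟩, -(S.1 *ᵥ p i₀)), ?_⟩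
      left_inv := fun x => ?_
      right_inv := fun _ => rfl }
  · have hx : ∀ i, x.1.1.1 *ᵥ p i + x.1.2 = 0 := fun i => congrFun (LinearMap.mem_ker.1 x.2) i
    exact (mulVec_eq_zero_on_vectorSpan p i₀ _).2 fun i =>
      add_right_cancel ((hx i).trans (hx i₀).symm)
  · rw [LinearMap.mem_ker]
    funext i
    exact add_neg_eq_zero.2 ((mulVec_eq_zero_on_vectorSpan p i₀ _).1 S.2.2 i)
  · have hx : x.1.1.1 *ᵥ p i₀ + x.1.2 = 0 := congrFun (LinearMap.mem_ker.1 x.2) i₀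
    exact Subtype.ext (Prod.ext rfl (neg_eq_of_add_eq_zero_right hx))

/-- For points `p 1, …, p n ∈ ℝ^d` whose affine span has dimension `ℓ`,
the space of trivial infinitesimal flexes (vectors `v` with `v i = S ⬝ p i + τ` for a
skew-symmetric `S` and a translation `τ`) has dimension `(ℓ+1)(2d−ℓ)/2`. -/
theorem dim_trivial_flexes
    (d n : ℕ) (hn : 0 < n)
    (p : Fin n → Fin d → ℝ)
    (ℓ : ℕ)
    (hℓ : ℓ = Module.finrank ℝ (affineSpan ℝ (Set.range p)).direction) :
    Module.finrank ℝ (Submodule.span ℝ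
      {v : Fin n → Fin d → ℝ | ∃ (S : Matrix (Fin d) (Fin d) ℝ) (τ : Fin d → ℝ),
        Sᵀ = -S ∧ ∀ i, v i = S.mulVec (p i) + τ})
      = (ℓ + 1) * (2 * d - ℓ) / 2 := by
  rw [direction_affineSpan] at hℓ
  have hle : ℓ ≤ d := by
    rw [hℓ]
    exact (Submodule.finrank_le _).trans_eq (Module.finrank_fin_fun ℝ)
  have hrank := (trivialFlexMap p).finrank_range_add_finrank_ker
  rw [finrank_ker_trivialFlexMap p ⟨0, hn⟩, finrank_skewMatricesVanishingOn, ← hℓ,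
    Module.finrank_prod, Module.finrank_fin_fun] at hrank
  rw [span_trivialFlexes_eq_range]
  have hd := finrank_skewMatrices_mul_two d
  have hk := finrank_skewMatrices_mul_two (d - ℓ)
  obtain ⟨k, rfl⟩ := Nat.exists_eq_add_of_le hle
  rw [Nat.add_sub_cancel_left] at hk hrank
  have hmul : ∀ m : ℕ, m * (m - 1) + m = m * m := by
    rintro (_ | m)
    · rfl
    · simp [Nat.mul_succ]
  have hsub : 2 * (ℓ + k) - ℓ = ℓ + 2 * k := by omega
  rw [hsub]
  symm
  apply Nat.div_eq_of_eq_mul_left two_pos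
  have h1 := hmul (ℓ + k)
  have h2 := hmul k
  nlinarith
end

section
/- Let (V, g, p) be a d-dimensional geometric constraint system: g : (ℝ^d)^n → ℝ^m has polynomial components invariant under Euclidean isometries of ℝ^d, and g(p) = 0. Let ℓ be the dimension of the affine span of {p_1,…,p_n}. Then the rank of the rigidity matrix (the Jacobian of g at p) satisfies rank R(p) ≤ nd − (ℓ+1)(2d−ℓ)/2. -/
open scoped BigOperators Matrix

/-- A linearly independent family in a finite-dimensional space extends to a basis. -/
theorem exists_basis_sum_fin_extending {V ι : Type*} [AddCommGroup V] [Module ℝ V]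
    [FiniteDimensional ℝ V] {v : ι → V} (hv : LinearIndependent ℝ v) :
    ∃ (e : ℕ) (b : Module.Basis (ι ⊕ Fin e) ℝ V), ∀ i, b (Sum.inl i) = v i := by
  obtain ⟨W, hW⟩ := Submodule.exists_isCompl (Submodule.span ℝ (Set.range v))
  refine ⟨_, ((Module.Basis.span hv).prod (Module.finBasis ℝ W)).map
    (Submodule.prodEquivOfIsCompl _ _ hW), fun i => ?_⟩
  simp [Module.Basis.span_apply]

section Infinitesimal

attribute [local instance] Matrix.linftyOpNormedRing Matrix.linftyOpNormedAlgebra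

/-- The exponential of a skew-symmetric matrix is orthogonal. -/
theorem exp_transpose_mul_exp_of_skew {d : ℕ} {A : Matrix (Fin d) (Fin d) ℝ} (hA : Aᵀ = -A) :
    (NormedSpace.exp A)ᵀ * NormedSpace.exp A = 1 := by
  rw [← Matrix.exp_transpose, hA, ← Matrix.exp_add_of_commute _ _ (Commute.refl A).neg_left]
  simp

/-- Infinitesimal isometries lie in the kernel of the derivative of an isometry-invariant map. -/
theorem fderiv_apply_infinitesimal_isometry {d n m : ℕ}
    {g : (Fin n → Fin d → ℝ) → Fin m → ℝ}
    (hinv : ∀ (Q : Matrix (Fin d) (Fin d) ℝ), Qᵀ * Q = 1 → ∀ (τ : Fin d → ℝ),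
      ∀ x : Fin n → Fin d → ℝ, g (fun i => Q.mulVec (x i) + τ) = g x)
    (p : Fin n → Fin d → ℝ) {A : Matrix (Fin d) (Fin d) ℝ} (hA : Aᵀ = -A) (τ : Fin d → ℝ) :
    fderiv ℝ g p (fun i => A *ᵥ p i + τ) = 0 := by
  by_cases hg : DifferentiableAt ℝ g p
  swap
  · rw [fderiv_zero_of_not_differentiableAt hg]; rfl
  let γ : ℝ → Fin n → Fin d → ℝ :=
    fun t i => NormedSpace.exp (t • A) *ᵥ p i + t • τ
  have hγ0 : γ 0 = p := by
    ext i j; simp [γ]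
  have hexp : HasDerivAt (fun t : ℝ => NormedSpace.exp (t • A)) A 0 := by
    have h := hasDerivAt_exp_smul_const (𝕂 := ℝ) A 0
    rw [zero_smul, NormedSpace.exp_zero, one_mul] at h
    exact h
  have hγ : HasDerivAt γ (fun i => A *ᵥ p i + τ) 0 := by
    rw [hasDerivAt_pi]
    intro i
    have hL := ((LinearMap.toContinuousLinearMap
      ((Matrix.mulVecBilin ℝ ℝ).flip (p i) :
        Matrix (Fin d) (Fin d) ℝ →ₗ[ℝ] (Fin d → ℝ))).hasFDerivAt).comp_hasDerivAt (0 : ℝ) hexp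
    have hτ : HasDerivAt (fun t : ℝ => t • τ) τ 0 := by
      simpa using (hasDerivAt_id (0 : ℝ)).smul_const τ
    exact hL.add hτ
  have hconst : g ∘ γ = fun _ => g p := by
    funext t
    refine hinv _ (exp_transpose_mul_exp_of_skew ?_) _ _
    rw [Matrix.transpose_smul, hA, smul_neg]
  have hg' : HasFDerivAt g (fderiv ℝ g p) (γ 0) := hγ0 ▸ hg.hasFDerivAt
  have h := hg'.comp_hasDerivAt (0 : ℝ) hγ
  rw [hconst] at h
  exact h.unique (hasDerivAt_const _ _)

end Infinitesimal

/-- There is a skew-symmetric matrix with prescribed entries below the diagonal in one diagonal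
block and prescribed entries in an off-diagonal block. -/
theorem exists_skew_matrix {ℓ e : ℕ} (c : (Σ j : Fin ℓ, Fin j) → ℝ) (c' : Fin e × Fin ℓ → ℝ) :
    ∃ C : Matrix (Fin ℓ ⊕ Fin e) (Fin ℓ ⊕ Fin e) ℝ, Cᵀ = -C ∧
      (∀ q, C (Sum.inl q.1) (Sum.inl (q.2.castLE q.1.2.le)) = c q) ∧
      ∀ q, C (Sum.inr q.1) (Sum.inl q.2) = c' q := by
  let L : Matrix (Fin ℓ) (Fin ℓ) ℝ := fun j k => if h : k < j then c ⟨j, ⟨k, h⟩⟩ else 0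
  let M : Matrix (Fin e) (Fin ℓ) ℝ := fun s j => c' (s, j)
  refine ⟨Matrix.fromBlocks (L - Lᵀ) (-Mᵀ) M 0, ?_, ?_, ?_⟩
  · rw [Matrix.fromBlocks_transpose, Matrix.fromBlocks_neg]
    simp
  · rintro ⟨j, k⟩
    have h1 : k.castLE j.2.le < j := k.2
    change L j (k.castLE j.2.le) - L (k.castLE j.2.le) j = c ⟨j, k⟩
    have h2 : L j (k.castLE j.2.le) = c ⟨j, k⟩ := dif_pos h1
    have h3 : L (k.castLE j.2.le) j = 0 := dif_neg h1.asymm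
    rw [h2, h3, sub_zero]
  · rintro ⟨s, j⟩
    rfl

/-- Every skew-symmetric array of entries in a given basis is realized by a skew-symmetric matrix. -/
theorem exists_skew_matrix_dotProduct_basis {d : ℕ} {κ : Type*} [Fintype κ] [DecidableEq κ]
    (b : Module.Basis κ ℝ (Fin d → ℝ)) {C : Matrix κ κ ℝ} (hC : Cᵀ = -C) :
    ∃ A : Matrix (Fin d) (Fin d) ℝ, Aᵀ = -A ∧ ∀ j k, b j ⬝ᵥ A *ᵥ b k = C j k := by
  let D : Matrix κ (Fin d) ℝ := b.toMatrix (Pi.basisFun ℝ (Fin d))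
  have hD : ∀ j, D *ᵥ b j = Pi.single j 1 := by
    intro j
    have h := (Pi.basisFun ℝ (Fin d)).toMatrix_mulVec_repr b (b j)
    rw [Module.Basis.repr_self, Finsupp.single_eq_pi_single] at h
    exact h
  refine ⟨Dᵀ * C * D, ?_, fun j k => ?_⟩
  · simp [Matrix.transpose_mul, hC, Matrix.mul_assoc]
  · rw [← Matrix.mulVec_mulVec, ← Matrix.mulVec_mulVec, Matrix.dotProduct_mulVec,
      Matrix.vecMul_transpose, hD, hD]
    simp

/-- Twice the number of pairs `k < j` in `Fin ℓ` is `ℓ * (ℓ - 1)`. -/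
theorem card_sigma_fin_mul_two (ℓ : ℕ) :
    Fintype.card (Σ j : Fin ℓ, Fin j) * 2 = ℓ * (ℓ - 1) := by
  rw [Fintype.card_sigma]
  simp only [Fintype.card_fin]
  rw [Fin.sum_univ_eq_sum_range (fun i => i), Finset.sum_range_id_mul_two]

/-- The space of infinitesimal isometries of a configuration whose affine span has dimension `ℓ`
has dimension at least `(ℓ + 1) * (2 * d - ℓ) / 2`, and so has any subspace containing it. -/
theorem le_finrank_of_infinitesimal_isometry_mem {d n : ℕ} (hn : 0 < n) (p : Fin n → Fin d → ℝ)
    (K : Submodule ℝ (Fin n → Fin d → ℝ))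
    (hK : ∀ A : Matrix (Fin d) (Fin d) ℝ, Aᵀ = -A → ∀ τ : Fin d → ℝ,
      (fun i => A *ᵥ p i + τ) ∈ K)
    {ℓ : ℕ} (hℓ : ℓ = Module.finrank ℝ (affineSpan ℝ (Set.range p)).direction) :
    (ℓ + 1) * (2 * d - ℓ) / 2 ≤ Module.finrank ℝ K := by
  let i₀ : Fin n := ⟨0, hn⟩
  rw [direction_affineSpan, vectorSpan_range_eq_span_range_vsub_right ℝ p i₀] at hℓ
  obtain ⟨idx, hidx⟩ : ∃ idx : Fin ℓ → Fin n,
      LinearIndependent ℝ fun j => p (idx j) - p i₀ := by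
    subst hℓ
    obtain ⟨v, hvmem, -, hv⟩ :=
      Submodule.exists_fun_fin_finrank_span_eq ℝ (Set.range fun i => p i -ᵥ p i₀)
    choose idx hidx using hvmem
    exact ⟨idx, by simpa only [← vsub_eq_sub, hidx] using hv⟩
  obtain ⟨e, b, hb⟩ := exists_basis_sum_fin_extending hidx
  have hd : ℓ + e = d := by
    simpa using (Module.finrank_eq_card_basis b).symm
  let Φ : (Fin n → Fin d → ℝ) →ₗ[ℝ]
      (Fin d → ℝ) × ((Σ j : Fin ℓ, Fin j) → ℝ) × (Fin e × Fin ℓ → ℝ) :=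
    { toFun := fun v => (v i₀,
        fun q => b (Sum.inl q.1) ⬝ᵥ (v (idx (q.2.castLE q.1.2.le)) - v i₀),
        fun q => b (Sum.inr q.1) ⬝ᵥ (v (idx q.2) - v i₀))
      map_add' := fun v w => by
        ext <;> simp [dotProduct_sub, dotProduct_add] <;> ring
      map_smul' := fun r v => by
        ext <;> simp [dotProduct_sub, dotProduct_smul] <;> ring }
  have hsurj : Function.Surjective (Φ.domRestrict K) := by
    rintro ⟨τ, c, c'⟩
    obtain ⟨C, hC, hc, hc'⟩ := exists_skew_matrix c c'
    obtain ⟨A, hA, hAC⟩ := exists_skew_matrix_dotProduct_basis b hC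
    have hdiff : ∀ j, A *ᵥ p (idx j) + (τ - A *ᵥ p i₀) - (A *ᵥ p i₀ + (τ - A *ᵥ p i₀))
        = A *ᵥ b (Sum.inl j) := by
      intro j
      rw [hb, Matrix.mulVec_sub]
      abel
    refine ⟨⟨_, hK A hA (τ - A *ᵥ p i₀)⟩, ?_⟩
    refine Prod.ext ?_ (Prod.ext ?_ ?_)
    · change A *ᵥ p i₀ + (τ - A *ᵥ p i₀) = τ
      abel
    · funext q
      refine Eq.trans ?_ (hc q)
      rw [← hAC, ← hdiff]
      rfl
    · funext q
      refine Eq.trans ?_ (hc' q)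
      rw [← hAC, ← hdiff]
      rfl
  have hle := LinearMap.finrank_le_finrank_of_surjective hsurj
  simp only [Module.finrank_prod, Module.finrank_fintype_fun_eq_card, Fintype.card_prod,
    Fintype.card_fin] at hle
  refine le_trans (Nat.div_le_of_le_mul ?_) hle
  have hcard := card_sigma_fin_mul_two ℓ
  have h2d : 2 * d - ℓ = ℓ + 2 * e := by omega
  rw [h2d, ← hd]
  cases ℓ with
  | zero => simp
  | succ k =>
    rw [Nat.add_sub_cancel] at hcard
    nlinarith

/-- For a `d`-dimensional geometric constraint system `(V, g, p)`
with affine span of `p 1, …, p n` of dimension `ℓ`, the rank of the rigidity matrix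
(the Jacobian of `g` at `p`) is at most `nd − (ℓ+1)(2d−ℓ)/2`. -/
theorem rank_rigidity_matrix_le
    (d n m : ℕ) (hn : 0 < n)
    (g : (Fin n → Fin d → ℝ) → Fin m → ℝ)
    -- the components of g are polynomials
    (hpoly : ∃ P : Fin m → MvPolynomial (Fin n × Fin d) ℝ,
      ∀ (x : Fin n → Fin d → ℝ) (i : Fin m),
        g x i = MvPolynomial.eval (fun v => x v.1 v.2) (P i))
    -- g is invariant under Euclidean isometries of ℝ^d
    (hinv : ∀ (Q : Matrix (Fin d) (Fin d) ℝ), Qᵀ * Q = 1 → ∀ (τ : Fin d → ℝ),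
      ∀ x : Fin n → Fin d → ℝ, g (fun i => Q.mulVec (x i) + τ) = g x)
    (p : Fin n → Fin d → ℝ) (hp : g p = 0)
    (ℓ : ℕ)
    (hℓ : ℓ = Module.finrank ℝ (affineSpan ℝ (Set.range p)).direction) :
    Module.finrank ℝ (LinearMap.range ((fderiv ℝ g p).toLinearMap))
      ≤ n * d - (ℓ + 1) * (2 * d - ℓ) / 2 := by
  have hrank := (fderiv ℝ g p).toLinearMap.finrank_range_add_finrank_ker
  have hker := le_finrank_of_infinitesimal_isometry_mem hn p (fderiv ℝ g p).toLinearMap.ker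
    (fun A hA τ => fderiv_apply_infinitesimal_isometry hinv p hA τ) hℓ
  have hdim : Module.finrank ℝ (Fin n → Fin d → ℝ) = n * d := by
    simp [Module.finrank_pi_fintype]
  omega
end

section
/- Let (V, g, p) be a d-dimensional geometric constraint system: g : (ℝ^d)^n → ℝ^m has polynomial components invariant under Euclidean isometries of ℝ^d, and g(p) = 0. Then the following are equivalent: (1) the system is not rigid, i.e., every neighborhood of p in (ℝ^d)^n contains a point q with g(q) = 0 that is not congruent to p; (2) there exists a real-analytic map α : [0,1] → (ℝ^d)^n with α(0) = p, g(α(t)) = 0 for all t ∈ [0,1], and some t ∈ [0,1] for which α(t) is not congruent to p. -/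
open scoped BigOperators Matrix
open Filter Topology

section
open MvPolynomial

theorem MvPolynomial.moduleFinite_quotient_of_pow_sub {σ R : Type*} [Finite σ] [CommRing R] {M : ℕ}
    (r : σ → MvPolynomial σ R) (hr : ∀ v, (r v).totalDegree < M) :
    Module.Finite R (MvPolynomial σ R ⧸ Ideal.span (Set.range fun v => X v ^ M - r v)) := by
  classical
  set I := Ideal.span (Set.range fun v => X v ^ M - r v)
  let π : MvPolynomial σ R →ₗ[R] MvPolynomial σ R ⧸ I := (Ideal.Quotient.mkₐ R I).toLinearMap
  have hfin : {m : σ →₀ ℕ | ∀ v, m v < M}.Finite := by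
    have := Fintype.ofFinite σ
    refine (Set.finite_Iic (Finsupp.equivFunOnFinite.symm fun _ : σ => M)).subset fun m hm => ?_
    exact Finsupp.le_def.2 fun v => (hm v).le
  let W : Submodule R (MvPolynomial σ R ⧸ I) :=
    Submodule.span R ((fun m => π (monomial m 1)) '' {m | ∀ v, m v < M})
  have key : ∀ n, ∀ m : σ →₀ ℕ, m.degree = n → π (monomial m 1) ∈ W := by
    intro n
    induction n using Nat.strong_induction_on with
    | _ n ih =>
      intro m hm
      by_cases h : ∀ v, m v < M
      · exact Submodule.subset_span ⟨m, h, rfl⟩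
      · push Not at h
        obtain ⟨v, hv⟩ := h
        obtain ⟨m', rfl⟩ : ∃ m', m = Finsupp.single v M + m' :=
          ⟨m - Finsupp.single v M, (add_tsub_cancel_of_le (by simpa using hv)).symm⟩
        have h1 : π (monomial (Finsupp.single v M + m') 1) = π (r v * monomial m' 1) := by
          refine Ideal.Quotient.eq.2 ?_
          have : (monomial (Finsupp.single v M + m') 1 : MvPolynomial σ R) - r v * monomial m' 1
              = (X v ^ M - r v) * monomial m' 1 := by
            rw [sub_mul, X_pow_eq_monomial, monomial_mul, one_mul]
          rw [this]
          exact I.mul_mem_right _ (Ideal.subset_span ⟨v, rfl⟩)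
        have h2 : r v * monomial m' 1
            = ∑ u ∈ (r v).support, (coeff u (r v)) • monomial (u + m') (1 : R) := by
          conv_lhs => rw [(r v).as_sum]
          rw [Finset.sum_mul]
          refine Finset.sum_congr rfl fun u _ => ?_
          rw [monomial_mul, smul_monomial, smul_eq_mul]
        rw [h1, h2, map_sum]
        refine Submodule.sum_mem _ fun u hu => ?_
        rw [map_smul]
        refine Submodule.smul_mem _ _ (ih _ ?_ _ rfl)
        have h3 : u.degree < M := (le_totalDegree hu).trans_lt (hr v)
        rw [← hm, map_add, map_add, Finsupp.degree_single]
        omega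
  refine ⟨Submodule.fg_def.2 ⟨_, hfin.image (fun m => π (monomial m 1)), ?_⟩⟩
  refine eq_top_iff.2 fun a _ => ?_
  obtain ⟨p, rfl⟩ := Ideal.Quotient.mk_surjective a
  change π p ∈ W
  rw [p.as_sum, map_sum]
  refine Submodule.sum_mem _ fun u _ => ?_
  rw [show monomial u (coeff u p) = coeff u p • monomial u (1 : R) by simp [smul_monomial],
    map_smul]
  exact W.smul_mem _ (key _ _ rfl)

theorem MvPolynomial.exists_monic_eval₂_eq_zero {σ R : Type*} [Finite σ] [CommRing R] {M : ℕ}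
    (r : σ → MvPolynomial σ R) (hr : ∀ v, (r v).totalDegree < M) (v : σ) :
    ∃ Q : Polynomial R, Q.Monic ∧ ∀ (ρ : R →+* ℝ) (x : σ → ℝ),
      (∀ v, x v ^ M = eval₂ ρ x (r v)) → Q.eval₂ ρ (x v) = 0 := by
  set I := Ideal.span (Set.range fun v => X v ^ M - r v) with hI
  have := moduleFinite_quotient_of_pow_sub r hr
  obtain ⟨Q, hQ, h⟩ := Algebra.IsIntegral.isIntegral (R := R) (Ideal.Quotient.mk I (X v))
  refine ⟨Q, hQ, fun ρ x hx => ?_⟩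
  have hle : ∀ a ∈ I, eval₂Hom ρ x a = 0 := by
    intro a ha
    have : I ≤ RingHom.ker (eval₂Hom ρ x) := by
      rw [hI, Ideal.span_le]
      rintro _ ⟨w, rfl⟩
      simp [RingHom.mem_ker, hx w]
    exact this ha
  have h' := congrArg (Ideal.Quotient.lift I (eval₂Hom ρ x) hle) h
  rw [Polynomial.hom_eval₂, map_zero] at h'
  convert h' using 2
  · ext a
    change ρ a = Ideal.Quotient.lift I (eval₂Hom ρ x) hle (Ideal.Quotient.mk I (C a))
    simp
  · simp

theorem MvPolynomial.exists_monic_eval₂_pderiv {σ R : Type*} [Fintype σ] [CommRing R] [Algebra ℚ R]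
    (Ψ : MvPolynomial σ R) :
    ∃ D : ℕ, ∀ v : σ, ∃ Q : Polynomial R, Q.Monic ∧ ∀ (ρ : R →+* ℝ) (x : σ → ℝ),
      (∀ v, eval₂ ρ x (pderiv v (Ψ + ∑ u, X u ^ D)) = 0) → Q.eval₂ ρ (x v) = 0 := by
  classical
  set M := 1 + ∑ v, (pderiv v Ψ).totalDegree
  let c : R := algebraMap ℚ R (-1 / (M + 1 : ℕ))
  refine ⟨M + 1, fun v => ?_⟩
  obtain ⟨Q, hQ, h⟩ := exists_monic_eval₂_eq_zero (M := M) (fun v => C c * pderiv v Ψ)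
    (fun v => by
      refine (totalDegree_mul _ _).trans_lt ?_
      have := Finset.single_le_sum (f := fun v => (pderiv v Ψ).totalDegree)
        (fun _ _ => Nat.zero_le _) (Finset.mem_univ v)
      simp only [totalDegree_C, M]
      omega) v
  refine ⟨Q, hQ, fun ρ x hx => h ρ x fun w => ?_⟩
  have h1 := hx w
  have h2 : pderiv w (∑ u : σ, (X u : MvPolynomial σ R) ^ (M + 1)) =
      ((M + 1 : ℕ) : MvPolynomial σ R) * X w ^ M := by
    rw [map_sum, Finset.sum_eq_single w]
    · simp
    · intro u _ hu
      simp [pderiv_X_of_ne hu]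
    · simp
  have hc : ρ c = -1 / (M + 1 : ℕ) := by
    have : ρ c = ((ρ.comp (algebraMap ℚ R)) (-1 / (M + 1 : ℕ))) := rfl
    rw [this, map_div₀, map_neg, map_one, map_natCast]
  rw [map_add, h2, eval₂_add, eval₂_mul, eval₂_pow, eval₂_X] at h1
  rw [eval₂_mul, eval₂_C, hc]
  have h3 : eval₂ ρ x (((M + 1 : ℕ) : MvPolynomial σ R)) = ((M + 1 : ℕ) : ℝ) := by
    simp
  rw [h3] at h1
  have : ((M + 1 : ℕ) : ℝ) ≠ 0 := by positivity
  field_simp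
  linarith

theorem MvPolynomial.hasDerivAt_eval_update {σ : Type*} [DecidableEq σ] (Φ : MvPolynomial σ ℝ)
    (x : σ → ℝ) (v : σ) :
    HasDerivAt (fun s => eval (Function.update x v s) Φ) (eval x (pderiv v Φ)) (x v) := by
  induction Φ using MvPolynomial.induction_on with
  | C a => simpa using hasDerivAt_const (x v) a
  | add p q hp hq => simpa using! hp.add hq
  | mul_X p u hp =>
    have h : HasDerivAt (fun s => Function.update x v s u) (eval x (pderiv v (X u))) (x v) := by
      by_cases huv : u = v
      · subst huv; simpa using! hasDerivAt_id (x u)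
      · simpa [pderiv_X_of_ne huv, huv] using hasDerivAt_const (x v) (x u)
    simpa [pderiv_mul, add_comm, mul_comm] using! hp.mul h

theorem MvPolynomial.eval_pderiv_eq_zero_of_isLocalMin {σ : Type*} (Φ : MvPolynomial σ ℝ)
    {x : σ → ℝ} (h : IsLocalMin (fun x => eval x Φ) x) (v : σ) : eval x (pderiv v Φ) = 0 := by
  classical
  refine IsLocalMin.hasDerivAt_eq_zero ?_ (hasDerivAt_eval_update Φ x v)
  have hc : ContinuousAt (fun s => Function.update x v s) (x v) := by
    fun_prop
  have := hc.tendsto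
  rw [Function.update_eq_self] at this
  filter_upwards [this.eventually h] with s hs
  simpa using hs
end

section
open Polynomial

theorem Polynomial.eval₂_eq_pow_mul_eval₂_reflect {R : Type*} [CommRing R] (i : R →+* ℝ) {δ : ℝ}
    (hδ : δ ≠ 0) {L : ℕ} {q : R[X]} (hq : q.natDegree ≤ L) :
    eval₂ i δ q = δ ^ L * eval₂ i δ⁻¹ (reflect L q) := by
  let := invertibleOfNonzero hδ
  rw [← eval₂_reflect_mul_pow i δ L q hq, mul_comm, invOf_eq_inv]

theorem Polynomial.exists_eval₂_eq_zero_of_tendsto_atTop (Q : ℝ[X][X][X]) (hQ : Q ≠ 0) :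
    ∃ P : ℝ[X][X], P ≠ 0 ∧ ∀ (t : ℝ) (l : Filter ℝ) [l.NeBot], l ≤ atTop →
      ∀ (y : ℝ → ℝ) (y₀ : ℝ), Tendsto y l (𝓝 y₀) →
      (∀ᶠ δ in l, Q.eval₂ (eval₂RingHom (evalRingHom t) δ) (y δ) = 0) →
      P.eval₂ (evalRingHom t) y₀ = 0 := by
  obtain ⟨k₀, hk₀, hmax⟩ := Finset.exists_max_image Q.support (fun k => (Q.coeff k).natDegree)
    (by simpa using hQ)
  set L := (Q.coeff k₀).natDegree
  have hL : ∀ k, (Q.coeff k).natDegree ≤ L := fun k => by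
    by_cases hk : k ∈ Q.support
    · exact hmax k hk
    · simp [notMem_support_iff.1 hk]
  refine ⟨∑ k ∈ Q.support, monomial k ((Q.coeff k).coeff L), ?_, ?_⟩
  · intro h
    have := congrArg (fun p => coeff p k₀) h
    simp only [finsetSum_coeff, coeff_monomial, Finset.sum_ite_eq', hk₀, if_true,
      coeff_zero] at this
    exact (mem_support_iff.1 hk₀) (leadingCoeff_eq_zero.1 this)
  · intro t l _ hl y y₀ hy h
    have hinv : Tendsto (fun δ : ℝ => δ⁻¹) l (𝓝 0) := tendsto_inv_atTop_zero.mono_left hl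
    have hev : ∀ᶠ δ in l, ∑ k ∈ Q.support,
        ((reflect L (Q.coeff k)).map (evalRingHom t)).eval δ⁻¹ * y δ ^ k = 0 := by
      filter_upwards [h, hl (eventually_gt_atTop 0)] with δ hδ hpos
      have hpos : 0 < δ := hpos
      rw [eval₂_eq_sum, Polynomial.sum] at hδ
      have : δ ^ L * ∑ k ∈ Q.support,
        ((reflect L (Q.coeff k)).map (evalRingHom t)).eval δ⁻¹ * y δ ^ k = 0 := by
        rw [← hδ, Finset.mul_sum]
        refine Finset.sum_congr rfl fun k _ => ?_
        rw [coe_eval₂RingHom, eval₂_eq_pow_mul_eval₂_reflect _ hpos.ne' (hL k), eval_map, mul_assoc]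
      exact (mul_eq_zero.1 this).resolve_left (by positivity)
    have hlim : Tendsto (fun δ => ∑ k ∈ Q.support,
        ((reflect L (Q.coeff k)).map (evalRingHom t)).eval δ⁻¹ * y δ ^ k) l
        (𝓝 (∑ k ∈ Q.support, ((reflect L (Q.coeff k)).map (evalRingHom t)).eval 0 * y₀ ^ k)) := by
      refine tendsto_finsetSum _ fun k _ => Tendsto.mul ?_ (hy.pow k)
      exact (Polynomial.continuous _).continuousAt.tendsto.comp hinv
    have h0 := tendsto_nhds_unique (hlim.congr' hev) tendsto_const_nhds
    rw [eval₂_finsetSum, ← h0]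
    refine Finset.sum_congr rfl fun k _ => ?_
    rw [eval₂_monomial, ← coeff_zero_eq_eval_zero, coeff_map, coeff_reflect,
      revAt_le (Nat.zero_le L), Nat.sub_zero]

theorem Polynomial.exists_map_eval_zero_ne_zero (P : ℝ[X][X]) (hP : P ≠ 0) :
    ∃ P' : ℝ[X][X], P'.map (evalRingHom 0) ≠ 0 ∧ ∀ t ≠ 0, ∀ y,
      P.eval₂ (evalRingHom t) y = 0 → P'.eval₂ (evalRingHom t) y = 0 := by
  obtain ⟨n, P', hdvd, rfl⟩ := WfDvdMonoid.max_power_factor hP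
    (prime_C_iff.2 (prime_X (R := ℝ))).irreducible
  refine ⟨P', fun h => hdvd (C_dvd_iff_dvd_coeff _ _ |>.2 fun k => ?_), fun t ht y h => ?_⟩
  · have := congrArg (fun p => coeff p k) h
    rw [X_dvd_iff, coeff_zero_eq_eval_zero]
    simpa using this
  · rw [eval₂_mul, eval₂_pow, eval₂_C] at h
    refine (mul_eq_zero.1 h).resolve_left ?_
    simpa using fun h => absurd h ht
end

theorem exists_tendsto_isLocalMin {σ : Type*} [Fintype σ] {f h G : (σ → ℝ) → ℝ}
    (hf : Continuous f) (hh : Continuous h) (hG : Continuous G) (hf0 : ∀ x, 0 ≤ f x)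
    {p a : σ → ℝ} (ha : f a = 0) (hha : 0 < h a) (hball : ∀ x, f x = 0 → x ∈ Metric.ball p 1)
    (l : Ultrafilter ℝ) (hl : (l : Filter ℝ) ≤ atTop) :
    ∃ (x : ℝ → σ → ℝ) (x₀ : σ → ℝ), Tendsto x l (𝓝 x₀) ∧ f x₀ = 0 ∧ 0 < h x₀ ∧
      ∀ᶠ δ in (l : Filter ℝ), IsLocalMin (fun x => δ ^ 2 * f x - δ * h x + G x) (x δ) := by
  have hK := isCompact_closedBall p (1 : ℝ)
  have hK' : (Metric.closedBall p (1 : ℝ)).Nonempty := ⟨p, by simp⟩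
  have haK : a ∈ Metric.closedBall p 1 := Metric.ball_subset_closedBall (hball a ha)
  have hmin : ∀ δ : ℝ, ∃ x ∈ Metric.closedBall p 1,
      IsMinOn (fun x => δ ^ 2 * f x - δ * h x + G x) (Metric.closedBall p 1) x := fun δ =>
    hK.exists_isMinOn hK' (by fun_prop)
  choose x hxK hx using hmin
  obtain ⟨x₀, hx₀K, hx₀⟩ := hK.ultrafilter_le_nhds (l.map x)
    (le_principal_iff.2 (Ultrafilter.mem_map.2 (Filter.univ_mem' hxK)))
  have hlim : Tendsto x l (𝓝 x₀) := hx₀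
  have hpos : ∀ᶠ δ : ℝ in l, 0 < δ := hl (eventually_gt_atTop 0)
  have hinv : Tendsto (fun δ : ℝ => δ⁻¹) l (𝓝 0) := tendsto_inv_atTop_zero.mono_left hl
  have hle : ∀ δ, δ ^ 2 * f (x δ) - δ * h (x δ) + G (x δ) ≤ - δ * h a + G a := fun δ => by
    have : δ ^ 2 * f (x δ) - δ * h (x δ) + G (x δ) ≤ δ ^ 2 * f a - δ * h a + G a := hx δ haK
    rw [ha] at this
    linarith
  have hfl := (hf.tendsto x₀).comp hlim
  have hhl := (hh.tendsto x₀).comp hlim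
  have hGl := (hG.tendsto x₀).comp hlim
  have hfx₀ : f x₀ = 0 := by
    refine le_antisymm ?_ (hf0 _)
    have hr : Tendsto (fun δ => δ⁻¹ * (h (x δ) - h a) + δ⁻¹ ^ 2 * (G a - G (x δ))) l
        (𝓝 (0 * (h x₀ - h a) + 0 ^ 2 * (G a - G x₀))) :=
      (hinv.mul (hhl.sub_const _)).add ((hinv.pow 2).mul (hGl.const_sub _))
    rw [zero_pow two_ne_zero, zero_mul, zero_mul, add_zero] at hr
    refine le_of_tendsto_of_tendsto hfl hr ?_
    filter_upwards [hpos] with δ hδ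
    have := hle δ
    have e : δ⁻¹ * (h (x δ) - h a) + δ⁻¹ ^ 2 * (G a - G (x δ))
        = (δ * (h (x δ) - h a) + (G a - G (x δ))) / δ ^ 2 := by
      field_simp
    simp only [Function.comp_apply]
    rw [e, le_div_iff₀ (by positivity)]
    linarith
  have hhx₀ : 0 < h x₀ := by
    refine hha.trans_le ?_
    have hr : Tendsto (fun δ => h (x δ) + δ⁻¹ * (G a - G (x δ))) l
        (𝓝 (h x₀ + 0 * (G a - G x₀))) := hhl.add (hinv.mul (hGl.const_sub _))
    rw [zero_mul, add_zero] at hr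
    refine ge_of_tendsto hr ?_
    filter_upwards [hpos] with δ hδ
    have h1 := hle δ
    have h2 := mul_nonneg (sq_nonneg δ) (hf0 (x δ))
    have e : h (x δ) + δ⁻¹ * (G a - G (x δ)) = (δ * h (x δ) + (G a - G (x δ))) / δ := by
      field_simp
    rw [e, le_div_iff₀ hδ]
    linarith
  refine ⟨x, x₀, hlim, hfx₀, hhx₀, ?_⟩
  filter_upwards [hlim.eventually (Metric.isOpen_ball.mem_nhds (hball x₀ hfx₀))] with δ hδ
  exact (hx δ).isLocalMin (Filter.mem_of_superset (Metric.isOpen_ball.mem_nhds hδ)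
    Metric.ball_subset_closedBall)

open scoped ContDiff in
theorem exists_analyticAt_implicit {f : ℝ × ℝ → ℝ} {x₀ c : ℝ} (hf : AnalyticAt ℝ f (0, x₀))
    (h0 : f (0, x₀) = 0) (hd : HasDerivAt (fun y => f (0, y)) c x₀) (hc : c ≠ 0) :
    ∃ φ : ℝ → ℝ, AnalyticAt ℝ φ 0 ∧ φ 0 = x₀ ∧ ∀ᶠ t in 𝓝 0, f (t, φ t) = 0 := by
  have cdf : ContDiffAt ℝ ω f (0, x₀) := hf.contDiffAt
  have hinv : (fderiv ℝ f (0, x₀) ∘L .inr ℝ ℝ ℝ).IsInvertible := by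
    refine ⟨ContinuousLinearEquiv.unitsEquivAut ℝ (Units.mk0 c hc), ?_⟩
    have h1 : HasFDerivAt (fun y : ℝ => f (0, y)) (fderiv ℝ f (0, x₀) ∘L .inr ℝ ℝ ℝ) x₀ :=
      hf.differentiableAt.hasFDerivAt.comp x₀ (hasFDerivAt_prodMk_right (0 : ℝ) x₀)
    rw [h1.unique hd.hasFDerivAt]
    ext
    simp
  have hω : (ω : WithTop ℕ∞) ≠ 0 := by simp
  refine ⟨cdf.implicitFunction hω hinv, (cdf.contDiffAt_implicitFunction hω hinv).analyticAt,
    cdf.implicitFunction_apply_self hω hinv, ?_⟩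
  simpa [h0] using cdf.eventually_apply_implicitFunction hω hinv

section
open Polynomial

/-- A family of real polynomials of degree at most `K` whose coefficients are analytic germs
at `0`. -/
structure IsAnalyticFamily (K : ℕ) (A : ℝ → ℝ[X]) : Prop where
  natDegree_le : ∀ t, (A t).natDegree ≤ K
  analyticAt_coeff : ∀ j, AnalyticAt ℝ (fun t => (A t).coeff j) 0

namespace IsAnalyticFamily

variable {K : ℕ} {A : ℝ → ℝ[X]}

theorem hasseDeriv (hA : IsAnalyticFamily K A) (k : ℕ) :
    IsAnalyticFamily K (fun t => Polynomial.hasseDeriv k (A t)) where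
  natDegree_le t := (natDegree_hasseDeriv_le _ _).trans ((Nat.sub_le _ _).trans (hA.natDegree_le t))
  analyticAt_coeff j := by
    simp only [hasseDeriv_coeff]
    exact analyticAt_const.mul (hA.analyticAt_coeff _)

theorem eval_eq (hA : IsAnalyticFamily K A) (t x : ℝ) :
    (A t).eval x = ∑ j ∈ Finset.range (K + 1), (A t).coeff j * x ^ j :=
  eval_eq_sum_range' (Nat.lt_succ_of_le (hA.natDegree_le t)) x

theorem analyticAt_eval {E : Type*} [NormedAddCommGroup E] [NormedSpace ℝ E]
    (hA : IsAnalyticFamily K A) {u v : E → ℝ} {z : E} (hu : AnalyticAt ℝ u z) (hu0 : u z = 0)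
    (hv : AnalyticAt ℝ v z) : AnalyticAt ℝ (fun z => (A (u z)).eval (v z)) z := by
  simp only [hA.eval_eq]
  refine Finset.analyticAt_fun_sum _ fun j _ => ?_
  refine AnalyticAt.mul ?_ (hv.pow j)
  exact AnalyticAt.fun_comp (g := fun t => (A t).coeff j) (hu0 ▸ hA.analyticAt_coeff j) hu

theorem taylor (hA : IsAnalyticFamily K A) {φ : ℝ → ℝ} (hφ : AnalyticAt ℝ φ 0) :
    IsAnalyticFamily K (fun t => Polynomial.taylor (φ t) (A t)) where
  natDegree_le t := by rw [natDegree_taylor]; exact hA.natDegree_le t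
  analyticAt_coeff j := by
    simp only [taylor_coeff]
    exact (hA.hasseDeriv j).analyticAt_eval analyticAt_id rfl hφ

theorem exists_taylor_coeff_eq_zero (hA : IsAnalyticFamily K A) {x₀ : ℝ} {k : ℕ}
    (h0 : (Polynomial.taylor x₀ (A 0)).coeff k = 0)
    (h1 : (Polynomial.taylor x₀ (A 0)).coeff (k + 1) ≠ 0) :
    ∃ φ : ℝ → ℝ, AnalyticAt ℝ φ 0 ∧ φ 0 = x₀ ∧
      ∀ᶠ t in 𝓝 0, (Polynomial.taylor (φ t) (A t)).coeff k = 0 := by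
  simp only [taylor_coeff] at h0 h1 ⊢
  refine exists_analyticAt_implicit
    (f := fun z => ((Polynomial.hasseDeriv k (A z.1)).eval z.2)) (c :=
      (k + 1 : ℕ) * (Polynomial.hasseDeriv (k + 1) (A 0)).eval x₀)
    ((hA.hasseDeriv k).analyticAt_eval analyticAt_fst rfl analyticAt_snd) h0 ?_ ?_
  · have := (Polynomial.hasseDeriv k (A 0)).hasDerivAt x₀
    convert! this using 1
    have h := congrArg (fun p => eval x₀ p)
      (LinearMap.congr_fun (hasseDeriv_comp (R := ℝ) 1 k) (A 0))
    simp only [LinearMap.comp_apply, hasseDeriv_one] at h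
    rw [h, add_comm 1 k]
    simp [add_mul]
  · exact mul_ne_zero (by positivity) h1

end IsAnalyticFamily

theorem exists_eventually_eq_pow_mul {f : ℝ → ℝ} (hf : AnalyticAt ℝ f 0) {m : ℕ}
    (hm : m ≤ analyticOrderAt f 0) :
    ∃ c : ℝ → ℝ, AnalyticAt ℝ c 0 ∧ (∀ᶠ s in 𝓝 0, f s = s ^ m * c s) ∧
      (analyticOrderAt f 0 = m → c 0 ≠ 0) := by
  by_cases h : analyticOrderAt f 0 = m
  · obtain ⟨c, hc, hc0, hfc⟩ := hf.analyticOrderAt_eq_natCast.1 h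
    exact ⟨c, hc, by simpa using hfc, fun _ => hc0⟩
  · obtain ⟨c, hc, hfc⟩ := (natCast_le_analyticOrderAt hf).1 hm
    exact ⟨c, hc, by simpa using hfc, fun h' => absurd h' h⟩

theorem analyticOrderAt_comp_pow {f : ℝ → ℝ} (hf : AnalyticAt ℝ f 0) {b : ℕ} (hb : b ≠ 0) :
    analyticOrderAt (fun s => f (s ^ b)) 0 = analyticOrderAt f 0 * b := by
  have h := AnalyticAt.analyticOrderAt_comp (f := f) (g := fun s : ℝ => s ^ b) (z₀ := 0)
    (by simpa [hb] using hf) (by fun_prop)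
  rw [zero_pow hb] at h
  have h2 := analyticOrderAt_centeredMonomial (𝕜 := ℝ) (z₀ := 0) (n := b)
  simp only [sub_zero] at h h2
  rw [← h2]
  exact h

/-- The Newton polygon step: after the substitution `(t, x) = (s ^ b, s ^ a * y)`, an analytic
family with vanishing `k - 1`-st coefficient becomes divisible by `s ^ (a * k)`, and the quotient
does not specialize at `s = 0` to a constant multiple of a `k`-th power. -/
theorem IsAnalyticFamily.exists_scaling {K k : ℕ} {B : ℝ → ℝ[X]} (hB : IsAnalyticFamily K B)
    (hlt : ∀ j < k, (B 0).coeff j = 0) (hk : (B 0).coeff k ≠ 0)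
    (hpred : ∀ j, j + 1 = k → ∀ᶠ t in 𝓝 0, (B t).coeff j = 0)
    (hex : ∃ j < k, ¬ ∀ᶠ t in 𝓝 0, (B t).coeff j = 0) :
    ∃ (a b : ℕ) (C : ℝ → ℝ[X]), a ≠ 0 ∧ b ≠ 0 ∧ IsAnalyticFamily K C ∧
      (C 0).coeff k ≠ 0 ∧ (∀ j > k, (C 0).coeff j = 0) ∧ (∀ j, j + 1 = k → (C 0).coeff j = 0) ∧
      (∃ j < k, (C 0).coeff j ≠ 0) ∧
      ∀ᶠ s in 𝓝 0, ∀ j, (j < k → (B (s ^ b)).coeff j = s ^ (a * (k - j)) * (C s).coeff j) ∧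
        (k ≤ j → (C s).coeff j = (B (s ^ b)).coeff j * s ^ (a * (j - k))) := by
  classical
  set r : ℕ → ℕ∞ := fun j => analyticOrderAt (fun t => (B t).coeff j) 0 with hr
  have hkK : k ≤ K := by
    by_contra h
    exact hk (coeff_eq_zero_of_natDegree_lt ((hB.natDegree_le 0).trans_lt (not_le.1 h)))
  obtain ⟨j₀, hj₀, hmin⟩ := Finset.exists_min_image
    ((Finset.range k).filter fun j => r j ≠ ⊤) (fun j => (r j).toNat * (k.factorial / (k - j)))
    (by
      obtain ⟨j, hj, h⟩ := hex
      exact ⟨j, by simpa [hj, hr, analyticOrderAt_eq_top] using h⟩)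
  simp only [Finset.mem_filter, Finset.mem_range] at hj₀ hmin
  set b := k.factorial with hbdef
  have hb : b ≠ 0 := k.factorial_ne_zero
  have hdiv : ∀ j < k, b / (k - j) * (k - j) = b := fun j hj =>
    Nat.div_mul_cancel (Nat.dvd_factorial (by omega) (Nat.sub_le _ _))
  set a := (r j₀).toNat * (b / (k - j₀)) with ha
  have ha0 : a ≠ 0 := by
    refine mul_ne_zero ?_ ?_
    · have h1 : r j₀ ≠ 0 := by
        rw [hr, (hB.analyticAt_coeff j₀).analyticOrderAt_ne_zero]
        exact hlt j₀ hj₀.1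
      simpa [ENat.toNat_eq_zero] using ⟨h1, hj₀.2⟩
    · intro h
      have := hdiv j₀ hj₀.1
      rw [h, zero_mul] at this
      exact hb this.symm
  have hcomp : ∀ j, AnalyticAt ℝ (fun s => (B (s ^ b)).coeff j) 0 := fun j =>
    AnalyticAt.fun_comp (g := fun t => (B t).coeff j)
      (by simpa [hb] using hB.analyticAt_coeff j) (by fun_prop)
  have hord : ∀ j, analyticOrderAt (fun s => (B (s ^ b)).coeff j) 0 = r j * b := fun j =>
    analyticOrderAt_comp_pow (hB.analyticAt_coeff j) hb
  have hexc : ∀ j, ∃ c : ℝ → ℝ, AnalyticAt ℝ c 0 ∧ (∀ᶠ s in 𝓝 0,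
      (j < k → (B (s ^ b)).coeff j = s ^ (a * (k - j)) * c s) ∧
      (k ≤ j → c s = (B (s ^ b)).coeff j * s ^ (a * (j - k)))) ∧ (j = j₀ → c 0 ≠ 0) := by
    intro j
    by_cases hj : j < k
    · have hle : ((a * (k - j) : ℕ) : ℕ∞) ≤ analyticOrderAt (fun s => (B (s ^ b)).coeff j) 0 := by
        rw [hord]
        by_cases hrj : r j = ⊤
        · rw [hrj, ENat.top_mul (by exact_mod_cast hb)]; exact le_top
        · rw [← ENat.natCast_toNat hrj, ← hdiv j hj]
          have := Nat.mul_le_mul_right (k - j) (hmin j ⟨hj, hrj⟩)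
          rw [mul_assoc (r j).toNat] at this
          exact_mod_cast this
      obtain ⟨c, hc, hfc, hc0⟩ := exists_eventually_eq_pow_mul (hcomp j) hle
      refine ⟨c, hc, hfc.mono fun s hs => ⟨fun _ => hs, fun h => absurd h (by omega)⟩, ?_⟩
      rintro rfl
      refine hc0 ?_
      rw [hord, ← ENat.natCast_toNat hj₀.2]
      rw [ha, mul_assoc, hdiv j hj]
      push_cast
      rfl
    · refine ⟨fun s => (B (s ^ b)).coeff j * s ^ (a * (j - k)), (hcomp j).mul (by fun_prop),
        Eventually.of_forall fun s => ⟨fun h => absurd h hj, fun _ => rfl⟩, ?_⟩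
      rintro rfl
      exact absurd hj₀.1 hj
  choose c hc hcB hc0 using hexc
  let C : ℝ → ℝ[X] := fun s => ∑ j ∈ Finset.range (K + 1), monomial j (c j s)
  have hcoeff : ∀ s j, (C s).coeff j = if j < K + 1 then c j s else 0 := fun s j => by
    simp [C, coeff_monomial]
  have hC0 : ∀ j, k < j → (C 0).coeff j = 0 := fun j hj => by
    rw [hcoeff]
    split_ifs with h
    · rw [(hcB j).self_of_nhds.2 hj.le,
        zero_pow (n := a * (j - k)) (mul_ne_zero ha0 (by omega)), mul_zero]
    · rfl
  have hcK : ∀ j ≤ k, ∀ s, (C s).coeff j = c j s := fun j hj s => by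
    rw [hcoeff, if_pos (by omega)]
  refine ⟨a, b, C, ha0, hb, ⟨fun t => ?_, fun j => ?_⟩, ?_, hC0, ?_, ⟨j₀, hj₀.1, ?_⟩, ?_⟩
  · exact natDegree_sum_le_of_forall_le _ _ fun j hj =>
      (natDegree_monomial_le _).trans (by simpa [Nat.lt_succ_iff] using hj)
  · simp only [hcoeff]
    split_ifs
    · exact hc j
    · exact analyticAt_const
  · rw [hcK k le_rfl, (hcB k).self_of_nhds.2 le_rfl]
    simpa [hb] using hk
  · rintro j rfl
    rw [hcK j (by omega)]
    have hpow : Tendsto (fun s : ℝ => s ^ b) (𝓝 0) (𝓝 0) := by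
      have := (continuous_pow (M := ℝ) b).tendsto 0
      rwa [zero_pow hb] at this
    have h1 : ∀ᶠ s in 𝓝[≠] 0, c j s = 0 := by
      filter_upwards [nhdsWithin_le_nhds (hpow.eventually (hpred j rfl)),
        nhdsWithin_le_nhds (hcB j), self_mem_nhdsWithin] with s h1 h2 h3
      rw [h2.1 (by omega)] at h1
      exact (mul_eq_zero.1 h1).resolve_left (pow_ne_zero _ h3)
    exact tendsto_nhds_unique
      (((hc j).continuousAt.tendsto.mono_left nhdsWithin_le_nhds).congr' h1) tendsto_const_nhds
  · rw [hcK j₀ hj₀.1.le]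
    exact hc0 j₀ rfl
  · have : ∀ᶠ s in 𝓝 (0 : ℝ), ∀ j ∈ Finset.range (K + 1),
      (j < k → (B (s ^ b)).coeff j = s ^ (a * (k - j)) * c j s) ∧
        (k ≤ j → c j s = (B (s ^ b)).coeff j * s ^ (a * (j - k))) :=
      (Finset.eventually_all _).2 fun j _ => hcB j
    filter_upwards [this] with s hs j
    by_cases hj : j < K + 1
    · simpa [hcoeff, hj] using hs j (Finset.mem_range.2 hj)
    · refine ⟨fun h => absurd h (by omega), fun _ => ?_⟩
      rw [hcoeff, if_neg hj, coeff_eq_zero_of_natDegree_lt (n := j), zero_mul]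
      exact (hB.natDegree_le _).trans_lt (by omega)

theorem Polynomial.natTrailingDegree_taylor_lt {k : ℕ} {p : ℝ[X]} (hk : p.coeff k ≠ 0)
    (hgt : ∀ j > k, p.coeff j = 0) (hpred : ∀ j, j + 1 = k → p.coeff j = 0)
    (hlt : ∃ j < k, p.coeff j ≠ 0) (y : ℝ) : (taylor y p).natTrailingDegree < k := by
  obtain ⟨j, hj, hpj⟩ := hlt
  obtain ⟨k, rfl⟩ : ∃ m, k = m + 1 := ⟨k - 1, by omega⟩
  by_cases hy : y = 0
  · rw [hy, taylor_zero]
    exact (natTrailingDegree_le_of_ne_zero hpj).trans_lt hj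
  · refine Nat.lt_succ_of_le (natTrailingDegree_le_of_ne_zero ?_)
    have h : hasseDeriv k p = C (((k + 1 : ℕ) : ℝ) * p.coeff (k + 1)) * X := by
      ext n
      rw [hasseDeriv_coeff, coeff_C_mul, coeff_X]
      rcases n with _ | _ | n
      · simp [hpred k rfl]
      · simp [add_comm]
      · simp [hgt (n + 1 + 1 + k) (by omega)]
    rw [taylor_coeff, h]
    simp only [eval_mul, eval_C, eval_X]
    exact mul_ne_zero (mul_ne_zero (by positivity) hk) hy

theorem Ultrafilter.exists_tendsto_nhds_or_tendsto_inv {ι : Type*} (l : Ultrafilter ι) (y : ι → ℝ) :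
    (∃ y₀, Tendsto y l (𝓝 y₀)) ∨ (Tendsto (fun i => (y i)⁻¹) l (𝓝 0) ∧ ∀ᶠ i in l, y i ≠ 0) := by
  by_cases h : ∃ M : ℝ, ∀ᶠ i in l, y i ∈ Metric.closedBall 0 M
  · obtain ⟨M, hM⟩ := h
    obtain ⟨y₀, -, hy₀⟩ := (isCompact_closedBall (0 : ℝ) M).ultrafilter_le_nhds (l.map y)
      (le_principal_iff.2 (Ultrafilter.mem_map.2 hM))
    exact Or.inl ⟨y₀, hy₀⟩
  · push Not at h
    have h' : ∀ M : ℝ, ∀ᶠ i in l, M < ‖y i‖ := fun M => by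
      simpa using h M
    refine Or.inr ⟨?_, (h' 0).mono fun i hi => norm_pos_iff.1 hi⟩
    refine Filter.tendsto_inv₀_cobounded.comp ?_
    rw [← tendsto_norm_atTop_iff_cobounded]
    exact tendsto_atTop.2 fun M => (h' M).mono fun i hi => hi.le

/-- **Newton–Puiseux theorem**, for a branch selected by an ultrafilter: a convergent selection of
real roots of an analytic family of polynomials is an analytic function of a root of the
parameter. -/
theorem IsAnalyticFamily.exists_root_parametrization {K : ℕ} {ι : Type*} (l : Ultrafilter ι)
    {A : ℝ → ℝ[X]} (hA : IsAnalyticFamily K A) (hA0 : A 0 ≠ 0) {x₀ : ℝ} {t x : ι → ℝ}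
    (ht : Tendsto t l (𝓝[>] 0)) (hx : Tendsto x l (𝓝 x₀))
    (hroot : ∀ᶠ i in l, (A (t i)).eval (x i) = 0) :
    ∃ q ≠ 0, ∃ ξ : ℝ → ℝ, AnalyticAt ℝ ξ 0 ∧ ξ 0 = x₀ ∧
      ∀ u : ι → ℝ, (∀ᶠ i in l, 0 < u i ∧ u i ^ q = t i) → ∀ᶠ i in l, x i = ξ (u i) := by
  induction hk : (Polynomial.taylor x₀ (A 0)).natTrailingDegree using Nat.strong_induction_on
    generalizing A x₀ t x with
  | _ k ih =>
    have ht0 : Tendsto t l (𝓝 0) := ht.mono_right nhdsWithin_le_nhds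
    have htpos : ∀ᶠ i in l, 0 < t i := ht.eventually self_mem_nhdsWithin
    have hT0 : Polynomial.taylor x₀ (A 0) ≠ 0 := by rwa [Ne, taylor_eq_zero]
    have hck : (Polynomial.taylor x₀ (A 0)).coeff k ≠ 0 := by
      rw [← hk, Ne, coeff_natTrailingDegree_eq_zero]; exact hT0
    have hclt : ∀ j < k, (Polynomial.taylor x₀ (A 0)).coeff j = 0 := fun j hj =>
      coeff_eq_zero_of_lt_natTrailingDegree (hk ▸ hj)
    rcases k with _ | k
    · exfalso
      have hev : Tendsto (fun i => (A (t i)).eval (x i)) l (𝓝 ((A 0).eval x₀)) := by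
        have h1 : AnalyticAt ℝ (fun z : ℝ × ℝ => (A z.1).eval z.2) (0, x₀) :=
          hA.analyticAt_eval analyticAt_fst rfl analyticAt_snd
        exact h1.continuousAt.tendsto.comp (ht0.prodMk_nhds hx)
      have := tendsto_nhds_unique (hev.congr' hroot) tendsto_const_nhds
      rw [taylor_coeff_zero] at hck
      exact hck this
    obtain ⟨φ, hφ, hφ0, hφk⟩ := hA.exists_taylor_coeff_eq_zero (hclt k (Nat.lt_succ_self k)) hck
    set B : ℝ → ℝ[X] := fun t => Polynomial.taylor (φ t) (A t) with hBdef
    have hB : IsAnalyticFamily K B := hA.taylor hφ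
    have hB0 : B 0 = Polynomial.taylor x₀ (A 0) := by simp only [hBdef, hφ0]
    set z : ι → ℝ := fun i => x i - φ (t i) with hz
    have hz0 : Tendsto z l (𝓝 0) := by
      have := hx.sub (hφ.continuousAt.tendsto.comp ht0)
      rwa [hφ0, sub_self] at this
    have hBroot : ∀ᶠ i in l, (B (t i)).eval (z i) = 0 := hroot.mono fun i hi => by
      simp only [hBdef, hz, taylor_eval, sub_add_cancel, hi]
    have hkK : k + 1 ≤ K := by
      by_contra h
      refine hck (coeff_eq_zero_of_natDegree_lt ?_)
      rw [← hB0]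
      exact (hB.natDegree_le 0).trans_lt (not_le.1 h)
    have hsum : ∀ g : ℕ → ℝ, (∀ j < k + 1, g j = 0) → (∀ j > k + 1, g j = 0) →
        ∑ j ∈ Finset.range (K + 1), g j = g (k + 1) := fun g h1 h2 => by
      refine Finset.sum_eq_single _ (fun j _ hj => ?_) fun h => absurd h (by simpa using hkK)
      rcases lt_or_gt_of_ne hj with h | h
      exacts [h1 j h, h2 j h]
    by_cases hex : ∃ j < k + 1, ¬ ∀ᶠ t in 𝓝 0, (B t).coeff j = 0
    · obtain ⟨a, b, C, ha, hb, hC, hCk, hCgt, hCpred, hClt, hBC⟩ := hB.exists_scaling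
        (hB0 ▸ hclt) (hB0 ▸ hck) (fun j hj => by
          obtain rfl : j = k := by omega
          exact hφk) hex
      set s : ι → ℝ := fun i => t i ^ ((b : ℝ)⁻¹) with hs
      have hspos : ∀ᶠ i in l, 0 < s i := htpos.mono fun i hi => Real.rpow_pos_of_pos hi _
      have hsb : ∀ᶠ i in l, s i ^ b = t i := htpos.mono fun i hi =>
        Real.rpow_inv_natCast_pow hi.le hb
      have hs0 : Tendsto s l (𝓝 0) := by
        have := ht0.rpow_const (p := (b : ℝ)⁻¹) (Or.inr (by positivity))
        rwa [Real.zero_rpow (by positivity)] at this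
      have hs' : Tendsto s l (𝓝[>] 0) := tendsto_nhdsWithin_iff.2 ⟨hs0, hspos⟩
      set y : ι → ℝ := fun i => z i / s i ^ a with hy
      have hzy : ∀ᶠ i in l, z i = s i ^ a * y i := hspos.mono fun i hi => by
        simp only [hy]; field_simp
      have hCroot : ∀ᶠ i in l, (C (s i)).eval (y i) = 0 := by
        filter_upwards [hspos, hsb, hzy, hBroot, hs0.eventually hBC] with i h1 h2 h3 h4 h5
        rw [h3, ← h2, hB.eval_eq] at h4
        have h6 : s i ^ (a * (k + 1)) * (C (s i)).eval (y i) = 0 := by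
          rw [← h4, hC.eval_eq, Finset.mul_sum]
          refine Finset.sum_congr rfl fun j _ => ?_
          rcases lt_or_ge j (k + 1) with hj | hj
          · rw [(h5 j).1 hj]
            obtain ⟨m, hm⟩ := Nat.exists_eq_add_of_le hj.le
            rw [hm, Nat.add_sub_cancel_left]
            ring_nf
          · rw [(h5 j).2 hj]
            obtain ⟨m, rfl⟩ := Nat.exists_eq_add_of_le hj
            rw [Nat.add_sub_cancel_left]
            ring_nf
        exact (mul_eq_zero.1 h6).resolve_left (by positivity)
      obtain ⟨y₀, hy₀⟩ : ∃ y₀, Tendsto y l (𝓝 y₀) := by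
        refine (l.exists_tendsto_nhds_or_tendsto_inv y).resolve_right ?_
        rintro ⟨hinv, hne⟩
        have hev : ∀ᶠ i in l, ∑ j ∈ Finset.range (K + 1), (if j < k + 1 then
            (C (s i)).coeff j * (y i)⁻¹ ^ (k + 1 - j)
            else (B (t i)).coeff j * z i ^ (j - (k + 1))) = 0 := by
          filter_upwards [hne, hsb, hzy, hCroot, hs0.eventually hBC] with i h1 h2 h3 h4 h5
          rw [hC.eval_eq] at h4
          refine (mul_eq_zero.1 (?_ : y i ^ (k + 1) * _ = 0)).resolve_left (pow_ne_zero _ h1)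
          rw [← h4, Finset.mul_sum]
          refine Finset.sum_congr rfl fun j _ => ?_
          split_ifs with hj
          · obtain ⟨m, hm⟩ := Nat.exists_eq_add_of_le hj.le
            rw [hm, Nat.add_sub_cancel_left]
            have h6 : y i ^ m * (y i)⁻¹ ^ m = 1 := by rw [← mul_pow, mul_inv_cancel₀ h1, one_pow]
            linear_combination (y i ^ j * (C (s i)).coeff j) * h6
          · rw [(h5 j).2 (not_lt.1 hj), h3, h2]
            obtain ⟨m, rfl⟩ := Nat.exists_eq_add_of_le (not_lt.1 hj)
            rw [Nat.add_sub_cancel_left]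
            ring_nf
        have hlim : Tendsto (fun i => ∑ j ∈ Finset.range (K + 1), (if j < k + 1 then
            (C (s i)).coeff j * (y i)⁻¹ ^ (k + 1 - j)
            else (B (t i)).coeff j * z i ^ (j - (k + 1)))) l
            (𝓝 (∑ j ∈ Finset.range (K + 1), (if j < k + 1 then
            (C 0).coeff j * 0 ^ (k + 1 - j)
            else (B 0).coeff j * 0 ^ (j - (k + 1))))) := by
          refine tendsto_finsetSum _ fun j _ => ?_
          split_ifs
          · exact ((hC.analyticAt_coeff j).continuousAt.tendsto.comp hs0).mul (hinv.pow _)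
          · exact ((hB.analyticAt_coeff j).continuousAt.tendsto.comp ht0).mul (hz0.pow _)
        have h0 := tendsto_nhds_unique (hlim.congr' hev) tendsto_const_nhds
        rw [hsum] at h0
        · simp only [lt_irrefl, if_false, Nat.sub_self, pow_zero, mul_one] at h0
          exact hck (hB0 ▸ h0)
        · intro j hj
          rw [if_pos hj, zero_pow (by omega), mul_zero]
        · intro j hj
          rw [if_neg (by omega), zero_pow (by omega), mul_zero]
      obtain ⟨q, hq, η, hη, hη0, h⟩ := ih _ (natTrailingDegree_taylor_lt hCk hCgt hCpred hClt y₀) hC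
        (fun h => hCk (by rw [h, coeff_zero])) hs' hy₀ hCroot rfl
      refine ⟨q * b, mul_ne_zero hq hb, fun u => φ (u ^ (q * b)) + (u ^ q) ^ a * η u, ?_, ?_, ?_⟩
      · refine AnalyticAt.add ?_ (AnalyticAt.mul (by fun_prop) hη)
        exact AnalyticAt.fun_comp (g := φ) (by simpa [hq, hb] using hφ) (by fun_prop)
      · simp [hq, hb, ha, hφ0]
      · intro u hu
        have hus : ∀ᶠ i in l, 0 < u i ∧ u i ^ q = s i := by
          filter_upwards [hu, hsb, hspos] with i h1 h2 h3
          refine ⟨h1.1, ?_⟩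
          have h4 : (u i ^ q) ^ b = s i ^ b := by rw [← pow_mul, h1.2, h2]
          exact (pow_left_inj₀ (pow_nonneg h1.1.le _) h3.le hb).1 h4
        filter_upwards [h u hus, hu, hus, hzy] with i h1 h2 h3 h4
        rw [h2.2, h3.2, ← h1, ← h4]
        simp [hz]
    · push Not at hex
      refine ⟨1, one_ne_zero, φ, hφ, hφ0, fun u hu => ?_⟩
      have hall : ∀ᶠ t in 𝓝 0, ∀ j ∈ Finset.range (k + 1), (B t).coeff j = 0 :=
        (Finset.eventually_all _).2 fun j hj => hex j (Finset.mem_range.1 hj)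
      have hlim : Tendsto (fun i => ∑ j ∈ Finset.range (K + 1), (if j < k + 1 then 0
            else (B (t i)).coeff j * z i ^ (j - (k + 1)))) l
            (𝓝 (∑ j ∈ Finset.range (K + 1), (if j < k + 1 then 0
            else (B 0).coeff j * 0 ^ (j - (k + 1))))) := by
        refine tendsto_finsetSum _ fun j _ => ?_
        split_ifs
        · exact tendsto_const_nhds
        · exact ((hB.analyticAt_coeff j).continuousAt.tendsto.comp ht0).mul (hz0.pow _)
      rw [hsum] at hlim
      · simp only [lt_irrefl, if_false, Nat.sub_self, pow_zero, mul_one] at hlim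
        filter_upwards [hlim.eventually_ne (hB0 ▸ hck), hu, hBroot, ht0.eventually hall]
          with i h1 h2 h3 h4
        rw [hB.eval_eq] at h3
        have h5 : z i ^ (k + 1) * ∑ j ∈ Finset.range (K + 1), (if j < k + 1 then 0
            else (B (t i)).coeff j * z i ^ (j - (k + 1))) = 0 := by
          refine Eq.trans ?_ h3
          rw [Finset.mul_sum]
          refine Finset.sum_congr rfl fun j _ => ?_
          split_ifs with hj
          · rw [h4 j (Finset.mem_range.2 hj), mul_zero, zero_mul]
          · obtain ⟨m, rfl⟩ := Nat.exists_eq_add_of_le (not_lt.1 hj)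
            rw [Nat.add_sub_cancel_left]
            ring
        have h6 : z i = 0 := by simpa using (mul_eq_zero.1 h5).resolve_right h1
        rw [show u i = t i by simpa using h2.2]
        simpa [hz, sub_eq_zero] using h6
      · intro j hj
        rw [if_pos hj]
      · intro j hj
        rw [if_neg (by omega), zero_pow (by omega), mul_zero]
end

section
open MvPolynomial

open Polynomial (evalRingHom eval₂RingHom) in
/-- The minimisers of `δ² (F + (‖x - p‖² - t)²) - δ H + ∑ xᵥ ^ D` have coordinates algebraic over
`ℝ(t, δ)`; letting `δ → ∞` selects a point of the fibre which is algebraic over `ℝ(t)`. -/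
theorem MvPolynomial.exists_algebraic_selection {σ : Type*} [Fintype σ] (F H : MvPolynomial σ ℝ)
    (hF : ∀ x, 0 ≤ eval x F) (p : σ → ℝ) :
    ∃ P : σ → Polynomial (Polynomial ℝ), (∀ v, (P v).map (evalRingHom 0) ≠ 0) ∧
      ∀ t, 0 < t → t < 1 → (∃ a, eval a F = 0 ∧ 0 < eval a H ∧ ∑ v, (a v - p v) ^ 2 = t) →
        ∃ a, (eval a F = 0 ∧ 0 < eval a H ∧ ∑ v, (a v - p v) ^ 2 = t) ∧
          ∀ v, (P v).eval₂ (evalRingHom t) (a v) = 0 := by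
  let c : ℝ →+* Polynomial (Polynomial ℝ) := Polynomial.C.comp Polynomial.C
  let τ : Polynomial (Polynomial ℝ) := Polynomial.C Polynomial.X
  let Ψ : MvPolynomial σ (Polynomial (Polynomial ℝ)) :=
    C (Polynomial.X ^ 2) * (map c F + (∑ v, (X v - C (c (p v))) ^ 2 - C τ) ^ 2) -
      C Polynomial.X * map c H
  obtain ⟨D, hD⟩ := exists_monic_eval₂_pderiv Ψ
  choose Q hQ hQ0 using hD
  choose P hP hP0 using fun v =>
    Polynomial.exists_eval₂_eq_zero_of_tendsto_atTop (Q v) (hQ v).ne_zero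
  choose P' hP' hP'0 using fun v => Polynomial.exists_map_eval_zero_ne_zero (P v) (hP v)
  refine ⟨P', hP', fun t ht ht1 ⟨a, haF, haH, hat⟩ => ?_⟩
  let f : (σ → ℝ) → ℝ := fun x => eval x F + (∑ v, (x v - p v) ^ 2 - t) ^ 2
  have hfz : ∀ x, f x = 0 → eval x F = 0 ∧ ∑ v, (x v - p v) ^ 2 = t := fun x hx => by
    have h1 := hF x
    have h2 := sq_nonneg (∑ v, (x v - p v) ^ 2 - t)
    have h3 : eval x F + (∑ v, (x v - p v) ^ 2 - t) ^ 2 = 0 := hx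
    exact ⟨by linarith, by nlinarith⟩
  have hball : ∀ x, f x = 0 → x ∈ Metric.ball p 1 := fun x hx => by
    rw [Metric.mem_ball, dist_pi_lt_iff one_pos]
    intro v
    have h1 := Finset.single_le_sum (f := fun v => (x v - p v) ^ 2) (fun _ _ => sq_nonneg _)
      (Finset.mem_univ v)
    rw [(hfz x hx).2] at h1
    rw [Real.dist_eq, ← sq_lt_one_iff_abs_lt_one]
    exact h1.trans_lt ht1
  obtain ⟨x, x₀, hx, hx₀, hHx₀, hmin⟩ := exists_tendsto_isLocalMin (f := f)
    (h := fun x => eval x H) (G := fun x => ∑ v, x v ^ D) (p := p) (a := a)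
    ((continuous_eval F).add (by fun_prop)) (continuous_eval H) (by fun_prop)
    (fun x => add_nonneg (hF x) (sq_nonneg _)) (by simp [f, haF, hat]) haH hball
    (Ultrafilter.of atTop) (Ultrafilter.of_le _)
  refine ⟨x₀, ⟨(hfz _ hx₀).1, hHx₀, (hfz _ hx₀).2⟩, fun v => hP'0 v t ht.ne' _ ?_⟩
  refine hP0 v t (Ultrafilter.of atTop : Ultrafilter ℝ) (Ultrafilter.of_le _) (fun δ => x δ v) _
    ((continuous_apply v).tendsto _ |>.comp hx) (hmin.mono fun δ hδ => ?_)
  refine hQ0 v _ _ fun w => ?_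
  rw [← eval_map, ← pderiv_map]
  refine eval_pderiv_eq_zero_of_isLocalMin _ ?_ w
  have hc : (eval₂RingHom (evalRingHom t) δ).comp c = RingHom.id ℝ := by
    ext r; simp [c]
  have hc' : ∀ r, Polynomial.eval₂ (evalRingHom t) δ (c r) = r := fun r => by simp [c]
  convert! hδ using 2 with y
  simp [Ψ, τ, f, map_map, hc, hc']

/-- A **curve selection lemma**: if `{F = 0, H > 0}` accumulates at a point `p`, then it is
reached from `p` along an analytic curve in `{F = 0}`. -/
theorem MvPolynomial.exists_analyticAt_curve {σ : Type*} [Fintype σ] (F H : MvPolynomial σ ℝ)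
    (hF : ∀ x, 0 ≤ eval x F) (p : σ → ℝ) (hHp : eval p H = 0)
    (hcl : ∀ U ∈ 𝓝 p, ∃ x ∈ U, eval x F = 0 ∧ 0 < eval x H) :
    ∃ α : ℝ → σ → ℝ, AnalyticAt ℝ α 0 ∧ α 0 = p ∧ (∀ᶠ s in 𝓝 0, eval (α s) F = 0) ∧
      ∃ᶠ s in 𝓝[>] 0, 0 < eval (α s) H := by
  obtain ⟨P, hP0, hP⟩ := exists_algebraic_selection F H hF p
  set T : Set ℝ := {t | ∃ a, eval a F = 0 ∧ 0 < eval a H ∧ ∑ v, (a v - p v) ^ 2 = t} with hT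
  have hfreq : ∃ᶠ t in 𝓝[>] 0, t ∈ T := by
    refine frequently_iff.2 fun {U} hU => ?_
    obtain ⟨ε, hε, hεU⟩ := Metric.mem_nhdsWithin_iff.1 hU
    have hcont : Continuous fun x : σ → ℝ => ∑ v, (x v - p v) ^ 2 := by fun_prop
    obtain ⟨x, hxU, hxF, hxH⟩ := hcl _
      ((hcont.isOpen_preimage _ Metric.isOpen_ball).mem_nhds
        (show ∑ v, (p v - p v) ^ 2 ∈ Metric.ball (0 : ℝ) ε by simpa using hε))
    refine ⟨_, hεU ⟨hxU, ?_⟩, x, hxF, hxH, rfl⟩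
    refine lt_of_le_of_ne (Finset.sum_nonneg fun v _ => sq_nonneg (x v - p v)) fun h => ?_
    have hxp : x = p := _root_.funext fun v => by
      have := (Finset.sum_eq_zero_iff_of_nonneg
        fun v _ => sq_nonneg (x v - p v)).1 h.symm v (Finset.mem_univ v)
      nlinarith
    rw [hxp, hHp] at hxH
    exact hxH.false
  have : (𝓝[>] (0 : ℝ) ⊓ 𝓟 T).NeBot := frequently_mem_iff_neBot.1 hfreq
  set l : Ultrafilter ℝ := Ultrafilter.of (𝓝[>] (0 : ℝ) ⊓ 𝓟 T)
  have hl : (l : Filter ℝ) ≤ 𝓝[>] 0 := (Ultrafilter.of_le _).trans inf_le_left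
  have hlT : ∀ᶠ t in l, t ∈ T := (Ultrafilter.of_le _).trans inf_le_right (mem_principal_self T)
  have hl0 : (l : Filter ℝ) ≤ 𝓝 0 := hl.trans nhdsWithin_le_nhds
  have hpos : ∀ᶠ t : ℝ in l, 0 < t := hl self_mem_nhdsWithin
  have hsel : ∀ t, ∃ a, 0 < t → t < 1 → t ∈ T →
      (eval a F = 0 ∧ 0 < eval a H ∧ ∑ v, (a v - p v) ^ 2 = t) ∧
        ∀ v, (P v).eval₂ (Polynomial.evalRingHom t) (a v) = 0 := fun t => by
    by_cases h : 0 < t ∧ t < 1 ∧ t ∈ T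
    · obtain ⟨a, ha⟩ := hP t h.1 h.2.1 h.2.2
      exact ⟨a, fun _ _ _ => ha⟩
    · exact ⟨0, fun h1 h2 h3 => absurd ⟨h1, h2, h3⟩ h⟩
  choose x hx using hsel
  have hx' : ∀ᶠ t in l, (eval (x t) F = 0 ∧ 0 < eval (x t) H ∧ ∑ v, (x t v - p v) ^ 2 = t) ∧
      ∀ v, (P v).eval₂ (Polynomial.evalRingHom t) (x t v) = 0 := by
    filter_upwards [hpos, hl0 (eventually_lt_nhds one_pos), hlT] with t h1 h2 h3
    exact hx t h1 h2 h3
  have hxlim : ∀ v, Tendsto (fun t => x t v) l (𝓝 (p v)) := fun v => by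
    rw [tendsto_iff_dist_tendsto_zero]
    have hsqrt : Tendsto Real.sqrt l (𝓝 0) := by
      simpa using (Real.continuous_sqrt.tendsto 0).mono_left hl0
    refine squeeze_zero' (Eventually.of_forall fun _ => dist_nonneg) (hx'.mono fun t ht => ?_) hsqrt
    rw [Real.dist_eq]
    refine Real.abs_le_sqrt ?_
    refine le_of_le_of_eq ?_ ht.1.2.2
    exact Finset.single_le_sum (f := fun v => (x t v - p v) ^ 2) (fun _ _ => sq_nonneg _)
      (Finset.mem_univ v)
  have hfam : ∀ v, IsAnalyticFamily (P v).natDegree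
      fun t => (P v).map (Polynomial.evalRingHom t) := fun v =>
    ⟨fun t => Polynomial.natDegree_map_le, fun j => by
      simpa using! AnalyticAt.aeval_polynomial (A := ℝ) analyticAt_id ((P v).coeff j)⟩
  choose q hq ξ hξ hξ0 hξx using fun v => (hfam v).exists_root_parametrization l (hP0 v)
    (t := id) (x := fun t => x t v) hl (hxlim v) (hx'.mono fun t ht => by
      simpa [Polynomial.eval_map] using ht.2 v)
  classical
  set N := ∏ v, q v
  have hN : N ≠ 0 := Finset.prod_ne_zero_iff.2 fun v _ => hq v
  have hr0 : ∀ v, ∏ w ∈ Finset.univ.erase v, q w ≠ 0 := fun v =>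
    Finset.prod_ne_zero_iff.2 fun w _ => hq w
  have hrN : ∀ v, (∏ w ∈ Finset.univ.erase v, q w) * q v = N := fun v =>
    Finset.prod_erase_mul _ _ (Finset.mem_univ v)
  set α : ℝ → σ → ℝ := fun s v => ξ v (s ^ ∏ w ∈ Finset.univ.erase v, q w) with hαdef
  have hα : AnalyticAt ℝ α 0 := analyticAt_pi_iff.2 fun v =>
    AnalyticAt.fun_comp (g := ξ v) (by simpa [hr0 v] using hξ v) (by fun_prop)
  set u : ℝ → ℝ := fun t => t ^ ((N : ℝ)⁻¹)
  have hupos : ∀ᶠ t in l, 0 < u t := hpos.mono fun t ht => Real.rpow_pos_of_pos ht _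
  have hu : Tendsto u l (𝓝[>] 0) := by
    refine tendsto_nhdsWithin_iff.2 ⟨?_, hupos⟩
    have := (tendsto_id.mono_left hl0).rpow_const (p := (N : ℝ)⁻¹) (Or.inr (by positivity))
    rwa [Real.zero_rpow (by positivity)] at this
  have hxα : ∀ᶠ t in l, x t = α (u t) := by
    have : ∀ v, ∀ᶠ t in l, x t v = α (u t) v := fun v =>
      hξx v (fun t => u t ^ ∏ w ∈ Finset.univ.erase v, q w) <| by
        filter_upwards [hpos, hupos] with t h1 h2
        refine ⟨pow_pos h2 _, ?_⟩
        rw [← pow_mul, hrN, Real.rpow_inv_natCast_pow h1.le hN, id]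
    exact (eventually_all.2 this).mono fun t => _root_.funext
  refine ⟨α, hα, ?_, ?_, ?_⟩
  · ext v
    simp [hαdef, hr0 v, hξ0]
  · have han : AnalyticAt ℝ (fun s => eval (α s) F) 0 := by
      simpa using! AnalyticAt.aeval_mvPolynomial (f := α) (analyticAt_pi_iff.1 hα) F
    refine han.frequently_zero_iff_eventually_zero.1 ?_
    refine (hu.mono_right (nhdsWithin_mono _ fun s hs => ne_of_gt hs)).frequently ?_
    exact (hx'.and hxα).frequently.mono fun t ht => ht.2 ▸ ht.1.1.1
  · exact hu.frequently ((hx'.and hxα).frequently.mono fun t ht => ht.2 ▸ ht.1.1.2.1)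
end

section
open MvPolynomial

/-- The sum over pairs of the squared changes in squared distance from `p`; it vanishes exactly at
the realizations congruent to `p`. -/
noncomputable def MvPolynomial.congruenceDefect {n d : ℕ} (p : Fin n → Fin d → ℝ) :
    MvPolynomial (Fin n × Fin d) ℝ :=
  ∑ i, ∑ j, (∑ k, (X (i, k) - X (j, k)) ^ 2 - C (∑ k, (p i k - p j k) ^ 2)) ^ 2

theorem MvPolynomial.eval_congruenceDefect {n d : ℕ} (p x : Fin n → Fin d → ℝ) :
    eval (fun v => x v.1 v.2) (congruenceDefect p) =
      ∑ i, ∑ j, (∑ k, (x i k - x j k) ^ 2 - ∑ k, (p i k - p j k) ^ 2) ^ 2 := by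
  simp [congruenceDefect]

theorem MvPolynomial.eval_congruenceDefect_nonneg {n d : ℕ} (p x : Fin n → Fin d → ℝ) :
    0 ≤ eval (fun v => x v.1 v.2) (congruenceDefect p) := by
  rw [eval_congruenceDefect]
  positivity

theorem MvPolynomial.eval_congruenceDefect_eq_zero_iff {n d : ℕ} (p x : Fin n → Fin d → ℝ) :
    eval (fun v => x v.1 v.2) (congruenceDefect p) = 0 ↔
      ∀ i j, Real.sqrt (∑ k, (p i k - p j k) ^ 2) = Real.sqrt (∑ k, (x i k - x j k) ^ 2) := by
  rw [eval_congruenceDefect, Finset.sum_eq_zero_iff_of_nonneg fun _ _ => by positivity]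
  simp only [Finset.mem_univ, true_imp_iff]
  refine forall_congr' fun i => ?_
  rw [Finset.sum_eq_zero_iff_of_nonneg fun _ _ => by positivity]
  simp only [Finset.mem_univ, true_imp_iff]
  refine forall_congr' fun j => ?_
  rw [Real.sqrt_inj (by positivity) (by positivity), sq_eq_zero_iff, sub_eq_zero, eq_comm]

theorem AnalyticAt.eval_mvPolynomial_uncurry {n d : ℕ} (P : MvPolynomial (Fin n × Fin d) ℝ)
    {α : ℝ → Fin n → Fin d → ℝ} {t : ℝ} (hα : AnalyticAt ℝ α t) :
    AnalyticAt ℝ (fun s => MvPolynomial.eval (fun v => α s v.1 v.2) P) t := by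
  simpa using! AnalyticAt.aeval_mvPolynomial (f := fun s (v : Fin n × Fin d) => α s v.1 v.2)
    (fun v => analyticAt_pi_iff.1 (analyticAt_pi_iff.1 hα v.1) v.2) P

end

/-- A geometric constraint system `(V, g, p)` is not rigid (every
neighborhood of `p` contains a realization not congruent to `p`) if and only if there
exists a real-analytic continuous motion `α : [0,1] → (ℝ^d)^n` with `α 0 = p`, staying in
`g⁻¹(0)`, and passing through a realization not congruent to `p`. -/
theorem not_rigid_iff_exists_analytic_motion
    (d n m : ℕ)
    (g : (Fin n → Fin d → ℝ) → Fin m → ℝ)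
    -- the components of g are polynomials
    (hpoly : ∃ P : Fin m → MvPolynomial (Fin n × Fin d) ℝ,
      ∀ (x : Fin n → Fin d → ℝ) (i : Fin m),
        g x i = MvPolynomial.eval (fun v => x v.1 v.2) (P i))
    -- g is invariant under Euclidean isometries of ℝ^d
    (hinv : ∀ (Q : Matrix (Fin d) (Fin d) ℝ), Qᵀ * Q = 1 → ∀ (τ : Fin d → ℝ),
      ∀ x : Fin n → Fin d → ℝ, g (fun i => Q.mulVec (x i) + τ) = g x)
    (p : Fin n → Fin d → ℝ) (hp : g p = 0) :
    -- (1) the system is not rigid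
    (∀ U : Set (Fin n → Fin d → ℝ), IsOpen U → p ∈ U →
      ∃ q ∈ U, g q = 0 ∧
        ¬ (∀ i j : Fin n, Real.sqrt (∑ k, (p i k - p j k) ^ 2)
            = Real.sqrt (∑ k, (q i k - q j k) ^ 2)))
    ↔
    -- (2) there is a nontrivial real-analytic motion through p
    (∃ α : ℝ → (Fin n → Fin d → ℝ),
      (∀ t ∈ Set.Icc (0 : ℝ) 1, AnalyticAt ℝ α t) ∧
      α 0 = p ∧
      (∀ t ∈ Set.Icc (0 : ℝ) 1, g (α t) = 0) ∧
      (∃ t ∈ Set.Icc (0 : ℝ) 1,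
        ¬ (∀ i j : Fin n, Real.sqrt (∑ k, (p i k - p j k) ^ 2)
            = Real.sqrt (∑ k, ((α t) i k - (α t) j k) ^ 2)))) := by
  obtain ⟨P, hP⟩ := hpoly
  have hiff : ∀ q : Fin n → Fin d → ℝ, ¬ (∀ i j : Fin n, Real.sqrt (∑ k, (p i k - p j k) ^ 2)
      = Real.sqrt (∑ k, (q i k - q j k) ^ 2)) ↔
      0 < MvPolynomial.eval (fun v => q v.1 v.2) (MvPolynomial.congruenceDefect p) := fun q => by
    rw [← MvPolynomial.eval_congruenceDefect_eq_zero_iff]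
    exact ⟨fun h => lt_of_le_of_ne (MvPolynomial.eval_congruenceDefect_nonneg p q) (Ne.symm h),
      ne_of_gt⟩
  simp only [hiff]
  constructor
  · intro h
    have hFg : ∀ x : Fin n → Fin d → ℝ,
        MvPolynomial.eval (fun v => x v.1 v.2) (∑ i, P i ^ 2) = 0 ↔ g x = 0 := fun x => by
      simp only [map_sum, map_pow, ← hP]
      rw [Finset.sum_eq_zero_iff_of_nonneg fun _ _ => sq_nonneg _]
      simp [funext_iff]
    obtain ⟨α, hα, hα0, hαF, hαH⟩ := MvPolynomial.exists_analyticAt_curve (∑ i, P i ^ 2)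
      (MvPolynomial.congruenceDefect p)
      (fun x => by simp only [map_sum, map_pow]; positivity) (fun v => p v.1 v.2)
      (by rw [MvPolynomial.eval_congruenceDefect]; simp)
      (fun U hU => by
        have hc : Continuous fun (x : Fin n → Fin d → ℝ) (v : Fin n × Fin d) => x v.1 v.2 := by
          fun_prop
        obtain ⟨V, hVU, hV, hpV⟩ := mem_nhds_iff.1 (hc.continuousAt.preimage_mem_nhds hU)
        obtain ⟨q, hqV, hq, hqH⟩ := h V hV hpV
        exact ⟨_, hVU hqV, (hFg q).2 hq, hqH⟩)
    obtain ⟨ε, hε, hαε⟩ := Metric.eventually_nhds_iff.1 (hα.eventually_analyticAt.and hαF)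
    obtain ⟨s, hsH, hs⟩ := (hαH.and_eventually (Ioo_mem_nhdsGT hε)).exists
    have hst : ∀ t ∈ Set.Icc (0 : ℝ) 1, dist (s * t) 0 < ε := fun t ht => by
      rw [Real.dist_0_eq_abs, abs_of_nonneg (mul_nonneg hs.1.le ht.1)]
      exact (mul_le_of_le_one_right hs.1.le ht.2).trans_lt hs.2
    refine ⟨fun t i k => α (s * t) (i, k), fun t ht => ?_, ?_, fun t ht => ?_, 1, by simp, ?_⟩
    · refine analyticAt_pi_iff.2 fun i => analyticAt_pi_iff.2 fun k => ?_
      exact AnalyticAt.fun_comp (g := fun u => α u (i, k))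
        (analyticAt_pi_iff.1 (hαε (hst t ht)).1 (i, k)) (by fun_prop)
    · ext i k
      simp [hα0]
    · exact (hFg _).1 (hαε (hst t ht)).2
    · simpa using hsH
  · rintro ⟨α, hα, hα0, hαg, t₁, ht₁, hH⟩ U hU hpU
    by_contra! hcon
    have hcont : ContinuousAt α 0 := (hα 0 (by simp)).continuousAt
    have hev : ∀ᶠ t in 𝓝 0, α t ∈ U := hcont.eventually (hU.mem_nhds (by rwa [hα0]))
    have hzero : ∀ᶠ t in 𝓝[>] (0 : ℝ), MvPolynomial.eval (fun v => α t v.1 v.2)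
        (MvPolynomial.congruenceDefect p) = 0 := by
      filter_upwards [nhdsWithin_le_nhds hev, Ioo_mem_nhdsGT one_pos] with t ht h01
      exact le_antisymm (hcon _ ht (hαg t (Set.Ioo_subset_Icc_self h01)))
        (MvPolynomial.eval_congruenceDefect_nonneg p _)
    have hfr := (hzero.frequently.filter_mono
      (nhdsWithin_mono (0 : ℝ) fun s (hs : 0 < s) => hs.ne'))
    have := AnalyticOnNhd.eqOn_zero_of_preconnected_of_frequently_eq_zero
      (fun t ht => (hα t ht).eval_mvPolynomial_uncurry (MvPolynomial.congruenceDefect p))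
      isPreconnected_Icc (Set.left_mem_Icc.2 zero_le_one) hfr ht₁
    exact hH.ne' this
end

section
/- Let g : ℝ^N → ℝ^m be twice differentiable at p, let v_1,…,v_r ∈ ker Dg(p) be linearly independent, and let ω_1,…,ω_s span the space of equilibrium stresses {ω ∈ ℝ^m : ω^T · Dg(p) = 0}. For λ ∈ ℝ^r define Q_i(λ) = ∑_{j=1}^r ∑_{k=1}^r λ_j λ_k · (ω_i)^T · D²g(p)(v_j, v_k) for i = 1,…,s. If there is no λ ∈ ℝ^r with ∑_{i=1}^r λ_i² = 1 and Q_1(λ) = ⋯ = Q_s(λ) = 0, then for every nonzero v in the span of v_1,…,v_r there exists an equilibrium stress ω with ω^T · D²g(p)(v,v) ≠ 0, and consequently there is no a ∈ ℝ^N with Dg(p)·a + D²g(p)(v,v) = 0. -/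
open scoped BigOperators

/-- A bilinear map paired with a covector, evaluated on the diagonal at a linear combination. -/
theorem sum_mul_bilin_sum_smul {ι κ E : Type*} [Fintype ι] [Fintype κ]
    [NormedAddCommGroup E] [NormedSpace ℝ E]
    (B : E →L[ℝ] E →L[ℝ] (κ → ℝ)) (w : κ → ℝ) (c : ι → ℝ) (v : ι → E) :
    ∑ t, w t * B (∑ j, c j • v j) (∑ k, c k • v k) t =
      ∑ j, ∑ k, c j * c k * ∑ t, w t * B (v j) (v k) t := by
  simp only [map_sum, map_smul, sum_apply, smul_apply,
    Finset.sum_apply, Pi.smul_apply, smul_eq_mul, Finset.mul_sum]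
  rw [Finset.sum_comm]
  nth_rewrite 2 [Finset.sum_comm]
  refine Finset.sum_congr rfl fun j _ => ?_
  rw [Finset.sum_comm]
  exact Finset.sum_congr rfl fun k _ => Finset.sum_congr rfl fun t _ => by ring

/-- A nonzero vector of real coordinates can be rescaled to the unit sphere. -/
theorem exists_sum_sq_mul_eq_one {ι : Type*} [Fintype ι] {c : ι → ℝ} (hc : c ≠ 0) :
    ∃ a : ℝ, ∑ i, (a * c i) ^ 2 = 1 := by
  obtain ⟨j, hj⟩ := Function.ne_iff.mp hc
  have hpos : 0 < ∑ i, c i ^ 2 :=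
    Finset.sum_pos' (fun i _ => sq_nonneg _) ⟨j, Finset.mem_univ j, sq_pos_of_ne_zero hj⟩
  refine ⟨(√(∑ i, c i ^ 2))⁻¹, ?_⟩
  simp only [mul_pow, ← Finset.mul_sum, inv_pow, Real.sq_sqrt hpos.le]
  exact inv_mul_cancel₀ (ne_of_gt hpos)

/-- Let `g : ℝ^N → ℝ^m` be twice differentiable at `p`, let
`v 1, …, v r` be linearly independent infinitesimal flexes, and let `ω 1, …, ω s` span
the space of equilibrium stresses at `p`. If the quadratic system
`Q i (λ) = ∑ j k, λ j * λ k * ⟨ω i, D²g(p)(v j, v k)⟩ = 0` (for all `i`) has no solution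
on the unit sphere `∑ λ i ² = 1`, then every nonzero `u` in the span of the `v j` is
blocked by some equilibrium stress and does not extend to a second-order flex. -/
theorem no_unblocked_flex_of_no_sphere_solution
    (N m r s : ℕ)
    (g : (Fin N → ℝ) → Fin m → ℝ) (p : Fin N → ℝ)
    -- g is twice differentiable at p
    (hg1 : DifferentiableAt ℝ g p)
    (hg2 : DifferentiableAt ℝ (fderiv ℝ g) p)
    -- v 1, …, v r are linearly independent infinitesimal flexes
    (v : Fin r → Fin N → ℝ)
    (hker : ∀ j, fderiv ℝ g p (v j) = 0)
    (hind : LinearIndependent ℝ v)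
    -- ω 1, …, ω s span the space of equilibrium stresses at p
    (ω : Fin s → Fin m → ℝ)
    (hspan : ∀ w : Fin m → ℝ,
      (∀ u : Fin N → ℝ, ∑ i, w i * fderiv ℝ g p u i = 0) ↔
        w ∈ Submodule.span ℝ (Set.range ω))
    -- there is no solution of Q₁ = ⋯ = Q_s = 0 on the unit sphere
    (hno : ¬ ∃ lam : Fin r → ℝ, (∑ i, lam i ^ 2 = 1) ∧
      ∀ i : Fin s, ∑ j, ∑ k,
        lam j * lam k * (∑ t, ω i t * fderiv ℝ (fderiv ℝ g) p (v j) (v k) t) = 0) :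
    ∀ u : Fin N → ℝ, u ∈ Submodule.span ℝ (Set.range v) → u ≠ 0 →
      (∃ w : Fin m → ℝ,
        (∀ z : Fin N → ℝ, ∑ i, w i * fderiv ℝ g p z i = 0) ∧
        (∑ t, w t * fderiv ℝ (fderiv ℝ g) p u u t) ≠ 0) ∧
      ¬ ∃ a : Fin N → ℝ, fderiv ℝ g p a + fderiv ℝ (fderiv ℝ g) p u u = 0 := by
  intro u hu hu0
  obtain ⟨c, rfl⟩ := (Submodule.mem_span_range_iff_exists_fun ℝ).mp hu
  have hc : c ≠ 0 := by
    rintro rfl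
    simp at hu0
  obtain ⟨a, ha⟩ := exists_sum_sq_mul_eq_one hc
  have hblock : ∃ w : Fin m → ℝ,
      (∀ z : Fin N → ℝ, ∑ i, w i * fderiv ℝ g p z i = 0) ∧
      (∑ t, w t * fderiv ℝ (fderiv ℝ g) p (∑ j, c j • v j) (∑ j, c j • v j) t) ≠ 0 := by
    by_contra! h
    refine hno ⟨fun i => a * c i, ha, fun i => ?_⟩
    have hQ := h (ω i) ((hspan _).mpr (Submodule.subset_span ⟨i, rfl⟩))
    rw [sum_mul_bilin_sum_smul] at hQ
    rw [← mul_zero (a ^ 2), ← hQ, Finset.mul_sum]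
    refine Finset.sum_congr rfl fun j _ => ?_
    rw [Finset.mul_sum]
    exact Finset.sum_congr rfl fun k _ => by ring
  refine ⟨hblock, ?_⟩
  rintro ⟨b, hb⟩
  obtain ⟨w, hw, hne⟩ := hblock
  apply hne
  rw [eq_neg_of_add_eq_zero_right hb]
  simpa using hw b
end

section
/- Let g : ℝ^n → ℝ^m be a smooth (C^∞) map, let p ∈ g^{-1}(0) be a point at which the Jacobian Dg(p) : ℝ^n → ℝ^m is surjective, and set T = ker Dg(p). Then there exist ε > 0, an open neighborhood W of p in ℝ^n, and a smooth map R_p : {v ∈ T : ‖v‖ < ε} → g^{-1}(0) such that: (1) for each v with ‖v‖ < ε, R_p(v) is the unique point of g^{-1}(0) ∩ W minimizing the Euclidean distance to p + v; (2) R_p(0) = p; (3) for each v ∈ T, the derivative d/dt R_p(tv) at t = 0 equals v; and (4) for each v ∈ T, the second derivative d²/dt² R_p(tv) at t = 0 is orthogonal to T. That is, the Euclidean-distance closest-point projection defines a local second-order retraction at p. -/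
open scoped BigOperators RealInnerProductSpace

open Filter Topology Metric
open scoped ContDiff

/-- Inverse function theorem: the local inverse is smooth on a whole neighbourhood. -/
lemma ContDiff.exists_contDiffAt_local_inverse
    {X Y : Type*} [NormedAddCommGroup X] [NormedSpace ℝ X] [CompleteSpace X]
    [NormedAddCommGroup Y] [NormedSpace ℝ Y] {Φ : X → Y} (hΦ : ContDiff ℝ ∞ Φ) {x : X}
    {e : X ≃L[ℝ] Y} (he : HasFDerivAt Φ (e : X →L[ℝ] Y) x) :
    ∃ Ψ : Y → X, Ψ (Φ x) = x ∧ HasFDerivAt Ψ (e.symm : Y →L[ℝ] X) (Φ x) ∧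
      ∀ᶠ y in 𝓝 (Φ x), ContDiffAt ℝ ∞ Ψ y ∧ Φ (Ψ y) = y := by
  have hstrict := hΦ.contDiffAt.hasStrictFDerivAt' he (by simp)
  set f := hstrict.toOpenPartialHomeomorph Φ with hf
  have hfΦ : (f : X → Y) = Φ := hstrict.toOpenPartialHomeomorph_coe
  have hx : x ∈ f.source := hstrict.mem_toOpenPartialHomeomorph_source
  have hsymm : f.symm (Φ x) = x := by rw [← hfΦ]; exact f.left_inv hx
  have htarget : Φ x ∈ f.target := by rw [← hfΦ]; exact f.map_source hx
  refine ⟨f.symm, hsymm, f.hasFDerivAt_symm htarget (by rwa [hsymm, hfΦ]), ?_⟩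
  have hcont : ContinuousAt (fun y => fderiv ℝ Φ (f.symm y)) (Φ x) :=
    (hΦ.continuous_fderiv (by simp)).continuousAt.comp (f.continuousAt_symm htarget)
  have hinv : ∀ᶠ y in 𝓝 (Φ x), fderiv ℝ Φ (f.symm y) ∈
      Set.range ((↑) : (X ≃L[ℝ] Y) → X →L[ℝ] Y) := by
    apply hcont
    simp only [hsymm, he.fderiv]
    exact e.nhds
  filter_upwards [hinv, f.open_target.mem_nhds htarget] with y ⟨e', he'⟩ hy
  refine ⟨f.contDiffAt_symm (f₀' := e') hy ?_ (by rw [hfΦ]; exact hΦ.contDiffAt), ?_⟩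
  · rw [he', hfΦ]
    exact (hΦ.differentiable (by simp) _).hasFDerivAt
  · rw [← hfΦ]
    exact f.right_inv hy

/-- A `C²` map satisfies a uniform quadratic first-order Taylor estimate near each point. -/
lemma ContDiff.exists_norm_sub_fderiv_le_sq
    {E F : Type*} [NormedAddCommGroup E] [NormedSpace ℝ E] [NormedAddCommGroup F] [NormedSpace ℝ F]
    {g : E → F} (hg : ContDiff ℝ 2 g) (p : E) :
    ∃ K : ℝ, ∃ r > 0, ∀ x ∈ ball p r, ∀ y ∈ ball p r,
      ‖g y - g x - fderiv ℝ g x (y - x)‖ ≤ K * ‖y - x‖ ^ 2 := by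
  have hg' : ContDiff ℝ 1 (fderiv ℝ g) := hg.fderiv_right (by norm_num)
  obtain ⟨K, t, ht, hK⟩ := hg'.contDiffAt (x := p) |>.exists_lipschitzOnWith
  obtain ⟨r, hr, hrt⟩ := Metric.mem_nhds_iff.1 ht
  refine ⟨K, r, hr, fun x hx y hy => ?_⟩
  have hseg : segment ℝ x y ⊆ ball p r := (convex_ball p r).segment_subset hx hy
  rw [pow_two, ← mul_assoc]
  refine (convex_segment x y).norm_image_sub_le_of_norm_hasFDerivWithin_le'
    (fun z _ => ((hg.differentiable (by simp)) z).hasFDerivAt.hasFDerivWithinAt)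
    (fun z hz => ?_) (left_mem_segment ℝ x y) (right_mem_segment ℝ x y)
  refine (hK.norm_sub_le (hrt (hseg hz)) (hrt hx)).trans ?_
  gcongr
  simpa using norm_sub_le_of_mem_segment hz

/-- A pairing of two `C²` curves which vanish to order two and one respectively at `t` has
vanishing second derivative at `t`. -/
lemma deriv_deriv_clm_apply_eq_zero
    {F : Type*} [NormedAddCommGroup F] [NormedSpace ℝ F]
    {l : ℝ → F →L[ℝ] ℝ} {b : ℝ → F} {t : ℝ} (hl : ContDiffAt ℝ 2 l t) (hb : ContDiffAt ℝ 2 b t)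
    (hlt : l t = 0) (hl't : deriv l t = 0) (hbt : b t = 0) :
    deriv (deriv fun s => l s (b s)) t = 0 := by
  have hfirst : deriv (fun s => l s (b s)) =ᶠ[𝓝 t]
      fun s => deriv l s (b s) + l s (deriv b s) := by
    filter_upwards [hl.eventually (by simp), hb.eventually (by simp)] with s hls hbs
    exact ((hls.differentiableAt (by simp)).hasDerivAt.clm_apply
      (hbs.differentiableAt (by simp)).hasDerivAt).deriv
  have hdiff {G : Type _} [NormedAddCommGroup G] [NormedSpace ℝ G] {f : ℝ → G}
      (hf : ContDiffAt ℝ 2 f t) : DifferentiableAt ℝ (deriv f) t :=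
    (hf.derivWithin (m := 1) (by norm_num)).differentiableAt (by simp)
  rw [hfirst.deriv_eq]
  have hd := ((hdiff hl).hasDerivAt.clm_apply (hb.differentiableAt (by simp)).hasDerivAt).add
    ((hl.differentiableAt (by simp)).hasDerivAt.clm_apply (hdiff hb).hasDerivAt)
  exact hd.deriv.trans (by simp [hlt, hl't, hbt])

lemma finrank_continuousDual (V : Type*) [NormedAddCommGroup V] [NormedSpace ℝ V]
    [FiniteDimensional ℝ V] : Module.finrank ℝ (V →L[ℝ] ℝ) = Module.finrank ℝ V :=
  (LinearMap.toContinuousLinearMap (𝕜 := ℝ) (E := V) (F' := ℝ)).finrank_eq.symm.trans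
    Subspace.dual_finrank_eq

section LagrangeMultipliers

variable {E F : Type*} [NormedAddCommGroup E] [InnerProductSpace ℝ E]
  [NormedAddCommGroup F] [NormedSpace ℝ F]

/-- The map whose fibre over `(innerSL ℝ z, 0)` consists of the critical points, with their
Lagrange multipliers, of the distance to `z` on the zero set of `g`. -/
noncomputable def lagrangeMap (g : E → F) (x : E × (F →L[ℝ] ℝ)) : (E →L[ℝ] ℝ) × F :=
  (innerSL ℝ x.1 + x.2 ∘L fderiv ℝ g x.1, g x.1)

/-- The linearization of `lagrangeMap` at a point with zero multiplier. -/
noncomputable def lagrangeLinear (A : E →L[ℝ] F) :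
    (E × (F →L[ℝ] ℝ)) →L[ℝ] ((E →L[ℝ] ℝ) × F) :=
  (((innerSL ℝ : E →L[ℝ] E →L[ℝ] ℝ) ∘L ContinuousLinearMap.fst ℝ E (F →L[ℝ] ℝ)) +
    ((ContinuousLinearMap.compL ℝ E F ℝ).flip A ∘L
      ContinuousLinearMap.snd ℝ E (F →L[ℝ] ℝ))).prod
    (A ∘L ContinuousLinearMap.fst ℝ E (F →L[ℝ] ℝ))

lemma lagrangeLinear_apply (A : E →L[ℝ] F) (x : E × (F →L[ℝ] ℝ)) :
    lagrangeLinear A x = (innerSL ℝ x.1 + x.2 ∘L A, A x.1) := rfl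

lemma lagrangeLinear_injective {A : E →L[ℝ] F} (hA : Function.Surjective A) :
    Function.Injective (lagrangeLinear A) := by
  rw [injective_iff_map_eq_zero]
  rintro ⟨h, l⟩ hz
  rw [lagrangeLinear_apply, Prod.mk_eq_zero] at hz
  obtain ⟨h₁, h₂⟩ := hz
  have hh : h = 0 := by simpa [h₂] using DFunLike.congr_fun h₁ h
  refine Prod.ext hh (ContinuousLinearMap.ext fun y => ?_)
  obtain ⟨x, rfl⟩ := hA y
  simpa [hh] using DFunLike.congr_fun h₁ x

lemma exists_equiv_eq_lagrangeLinear [FiniteDimensional ℝ E] [FiniteDimensional ℝ F]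
    {A : E →L[ℝ] F} (hA : Function.Surjective A) :
    ∃ e : (E × (F →L[ℝ] ℝ)) ≃L[ℝ] ((E →L[ℝ] ℝ) × F),
      (e : (E × (F →L[ℝ] ℝ)) →L[ℝ] ((E →L[ℝ] ℝ) × F)) = lagrangeLinear A := by
  have hdim : Module.finrank ℝ (E × (F →L[ℝ] ℝ)) = Module.finrank ℝ ((E →L[ℝ] ℝ) × F) := by
    rw [Module.finrank_prod, Module.finrank_prod, finrank_continuousDual, finrank_continuousDual]
  refine ⟨((lagrangeLinear A).toLinearMap.linearEquivOfInjective
    (lagrangeLinear_injective hA) hdim).toContinuousLinearEquiv, ?_⟩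
  refine ContinuousLinearMap.ext fun x => ?_
  exact LinearMap.linearEquivOfInjective_apply (lagrangeLinear_injective hA) hdim x

lemma contDiff_lagrangeMap {g : E → F} (hg : ContDiff ℝ ∞ g) : ContDiff ℝ ∞ (lagrangeMap g) := by
  have hg' : ContDiff ℝ ∞ (fderiv ℝ g) := hg.fderiv_right (by simp)
  exact ((((innerSL ℝ : E →L[ℝ] E →L[ℝ] ℝ).contDiff.comp contDiff_fst).add
    (contDiff_snd.clm_comp (hg'.comp contDiff_fst))).prodMk (hg.comp contDiff_fst))

lemma hasFDerivAt_lagrangeMap {g : E → F} (hg : ContDiff ℝ 2 g) (p : E) :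
    HasFDerivAt (lagrangeMap g) (lagrangeLinear (fderiv ℝ g p)) (p, 0) := by
  have hg' : ContDiff ℝ 1 (fderiv ℝ g) := hg.fderiv_right (by norm_num)
  have hfst : HasFDerivAt (Prod.fst : E × (F →L[ℝ] ℝ) → E)
      (ContinuousLinearMap.fst ℝ E (F →L[ℝ] ℝ)) (p, 0) := hasFDerivAt_fst
  have hsnd : HasFDerivAt (Prod.snd : E × (F →L[ℝ] ℝ) → F →L[ℝ] ℝ)
      (ContinuousLinearMap.snd ℝ E (F →L[ℝ] ℝ)) (p, 0) := hasFDerivAt_snd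
  have hD := (hg'.differentiable (by simp) p).hasFDerivAt.comp (p, (0 : F →L[ℝ] ℝ)) hfst
  have hG := (hg.differentiable (by simp) p).hasFDerivAt.comp (p, (0 : F →L[ℝ] ℝ)) hfst
  have hI := (innerSL ℝ : E →L[ℝ] E →L[ℝ] ℝ).hasFDerivAt.comp (p, (0 : F →L[ℝ] ℝ)) hfst
  refine ((hI.add (hsnd.clm_comp hD)).prodMk hG).congr_fderiv ?_
  ext x <;> simp [lagrangeLinear_apply, innerSL_apply_apply ℝ]

/-- A critical point with a small Lagrange multiplier is strictly closer to `z` than `y`, as soon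
as the constraint `A (y - x)` is quadratically small. -/
lemma norm_sub_lt_norm_sub_of_lagrange {x y z : E} {l : F →L[ℝ] ℝ} {A : E →L[ℝ] F} {K : ℝ}
    (hxz : innerSL ℝ x + l ∘L A = innerSL ℝ z) (hA : ‖A (y - x)‖ ≤ K * ‖y - x‖ ^ 2)
    (hl : ‖l‖ * K < 1 / 2) (hyx : y ≠ x) : ‖z - x‖ < ‖z - y‖ := by
  have hinner : inner ℝ (z - x) (y - x) = l (A (y - x)) := by
    have h := DFunLike.congr_fun hxz (y - x)
    simp only [add_apply, ContinuousLinearMap.comp_apply,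
      innerSL_apply_apply] at h
    rw [inner_sub_left]
    linarith
  have hpos : 0 < ‖y - x‖ ^ 2 := pow_pos (norm_pos_iff.2 (sub_ne_zero.2 hyx)) 2
  have hlt : inner ℝ (z - x) (y - x) < 1 / 2 * ‖y - x‖ ^ 2 := calc
    inner ℝ (z - x) (y - x) ≤ ‖l‖ * ‖A (y - x)‖ :=
      hinner.le.trans ((le_abs_self _).trans (l.le_opNorm _))
    _ ≤ ‖l‖ * (K * ‖y - x‖ ^ 2) := by gcongr
    _ = ‖l‖ * K * ‖y - x‖ ^ 2 := by ring
    _ < 1 / 2 * ‖y - x‖ ^ 2 := by gcongr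
  have hsq := norm_sub_sq_real (z - x) (y - x)
  rw [sub_sub_sub_cancel_right] at hsq
  exact lt_of_pow_lt_pow_left₀ 2 (norm_nonneg _) (by linarith)

end LagrangeMultipliers

/-- For a smooth map `g : ℝ^n → ℝ^m`, a point `p ∈ g⁻¹(0)` at which
`Dg(p)` is surjective, and `T = ker Dg(p)`, the Euclidean-distance closest-point
projection defines a local second-order retraction at `p`: there are `ε > 0`, an open
neighborhood `W` of `p`, and a smooth map `R : {v ∈ T : ‖v‖ < ε} → g⁻¹(0)` such that
`R v` is the unique closest point of `g⁻¹(0) ∩ W` to `p + v`, `R 0 = p`,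
`(d/dt) R (t • v)|₀ = v`, and `(d²/dt²) R (t • v)|₀ ⊥ T`. -/
theorem euclidean_distance_retraction
    (n m : ℕ)
    (g : EuclideanSpace ℝ (Fin n) → EuclideanSpace ℝ (Fin m))
    (hg : ContDiff ℝ (⊤ : ℕ∞) g)
    (p : EuclideanSpace ℝ (Fin n)) (hp : g p = 0)
    (hsurj : Function.Surjective (fderiv ℝ g p))
    (T : Submodule ℝ (EuclideanSpace ℝ (Fin n)))
    (hT : T = LinearMap.ker ((fderiv ℝ g p).toLinearMap)) :
    ∃ ε : ℝ, 0 < ε ∧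
    ∃ W : Set (EuclideanSpace ℝ (Fin n)), IsOpen W ∧ p ∈ W ∧
    ∃ R : T → EuclideanSpace ℝ (Fin n),
      -- R is smooth on {v ∈ T : ‖v‖ < ε}
      ContDiffOn ℝ (⊤ : ℕ∞) R (Metric.ball (0 : T) ε) ∧
      -- (1) R v is the unique point of g⁻¹(0) ∩ W closest to p + v
      (∀ v : T, ‖v‖ < ε →
        g (R v) = 0 ∧ R v ∈ W ∧
        ∀ y : EuclideanSpace ℝ (Fin n), g y = 0 → y ∈ W → y ≠ R v →
          ‖p + (v : EuclideanSpace ℝ (Fin n)) - R v‖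
            < ‖p + (v : EuclideanSpace ℝ (Fin n)) - y‖) ∧
      -- (2) R 0 = p
      R 0 = p ∧
      -- (3) first derivative along rays is the identity
      (∀ v : T, deriv (fun t : ℝ => R (t • v)) 0 = (v : EuclideanSpace ℝ (Fin n))) ∧
      -- (4) second derivative along rays is orthogonal to T
      (∀ v w : T,
        ⟪deriv (deriv (fun t : ℝ => R (t • v))) 0,
          (w : EuclideanSpace ℝ (Fin n))⟫ = 0) := by
  have htwo : (2 : WithTop ℕ∞) ≤ ∞ := WithTop.coe_le_coe.2 (le_top : (2 : ℕ∞) ≤ ⊤)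
  have hg2 : ContDiff ℝ 2 g := hg.of_le htwo
  set A := fderiv ℝ g p with hA
  have hker (v : T) : A v = 0 := by
    have hv : (v : EuclideanSpace ℝ (Fin n)) ∈ LinearMap.ker A.toLinearMap := hT ▸ v.2
    exact hv
  obtain ⟨e, he⟩ := exists_equiv_eq_lagrangeLinear hsurj
  obtain ⟨Ψ, hΨp, hΨ', hΨ⟩ := (contDiff_lagrangeMap hg).exists_contDiffAt_local_inverse
    (he ▸ hasFDerivAt_lagrangeMap hg2 p : HasFDerivAt (lagrangeMap g) (e : _ →L[ℝ] _) (p, 0))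
  obtain ⟨K, r, hr, hK⟩ := hg2.exists_norm_sub_fderiv_le_sq p
  let q : T → (EuclideanSpace ℝ (Fin n) →L[ℝ] ℝ) × EuclideanSpace ℝ (Fin m) :=
    fun v => (innerSL ℝ (p + v), 0)
  have hq : ContDiff ℝ ∞ q :=
    ((innerSL ℝ : EuclideanSpace ℝ (Fin n) →L[ℝ] _).contDiff.comp
      (contDiff_const.add T.subtypeL.contDiff)).prodMk contDiff_const
  have hq0 : q 0 = lagrangeMap g (p, 0) := by simp [q, lagrangeMap, hp]
  rw [← hq0] at hΨp hΨ' hΨ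
  have hcont : ContinuousAt (fun v => Ψ (q v)) 0 :=
    hΨ'.continuousAt.comp hq.continuous.continuousAt
  have hev : ∀ᶠ v in 𝓝 (0 : T), (ContDiffAt ℝ ∞ Ψ (q v) ∧ lagrangeMap g (Ψ (q v)) = q v) ∧
      (Ψ (q v)).1 ∈ ball p r ∧ ‖(Ψ (q v)).2‖ * K < 1 / 2 := by
    refine (hq.continuous.continuousAt.eventually hΨ).and (Eventually.and ?_ ?_)
    · refine hcont.fst.eventually_mem ?_
      simpa [hΨp] using ball_mem_nhds p hr
    · refine (hcont.snd.norm.mul continuousAt_const).eventually_lt continuousAt_const ?_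
      simp [hΨp]
  obtain ⟨ε, hε, hball⟩ := Metric.eventually_nhds_iff_ball.1 hev
  have hray (v : T) : ContDiff ℝ ∞ fun t : ℝ => t • v := contDiff_id.smul contDiff_const
  have hcurve (v : T) : ContDiffAt ℝ 2 (fun t : ℝ => Ψ (q (t • v))) 0 := by
    have h := (hball 0 (mem_ball_self hε)).1.1
    rw [← zero_smul ℝ v] at h
    exact (h.comp (0 : ℝ) (hq.comp (hray v)).contDiffAt).of_le htwo
  have hcurve' (v : T) : HasDerivAt (fun t : ℝ => Ψ (q (t • v))) ((v : _), 0) 0 := by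
    have hline : HasDerivAt (fun t : ℝ => p + ((t • v : T) : EuclideanSpace ℝ (Fin n))) v 0 := by
      simpa using ((hasDerivAt_id (0 : ℝ)).smul_const
        (v : EuclideanSpace ℝ (Fin n))).const_add p
    have hqv : HasDerivAt (fun t : ℝ => q (t • v)) (innerSL ℝ (v : EuclideanSpace ℝ (Fin n)), 0) 0 :=
      ((innerSL ℝ : EuclideanSpace ℝ (Fin n) →L[ℝ] _).hasFDerivAt.comp_hasDerivAt 0 hline).prodMk
        (hasDerivAt_const _ _)
    have hev' : e ((v : _), 0) = (innerSL ℝ (v : EuclideanSpace ℝ (Fin n)), 0) := by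
      rw [← ContinuousLinearEquiv.coe_coe, he, lagrangeLinear_apply]
      simp [hker]
    have h := HasFDerivAt.comp_hasDerivAt_of_eq (0 : ℝ) hΨ' hqv (by simp)
    rw [← hev'] at h
    exact h.congr_deriv (by simp)
  refine ⟨ε, hε, ball p r, isOpen_ball, mem_ball_self hr, fun v => (Ψ (q v)).1, ?_, ?_, ?_, ?_, ?_⟩
  · intro v hv
    exact ((hball v hv).1.1.comp v hq.contDiffAt).fst.contDiffWithinAt
  · intro v hv
    obtain ⟨⟨-, heq⟩, hmem, hsmall⟩ := hball v (by simpa using hv)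
    obtain ⟨hcrit, hzero⟩ := Prod.ext_iff.1 heq
    replace hzero : g (Ψ (q v)).1 = 0 := hzero
    refine ⟨hzero, hmem, fun y hy hyW hne => ?_⟩
    refine norm_sub_lt_norm_sub_of_lagrange hcrit ?_ hsmall hne
    simpa [hy, hzero, -map_sub] using hK _ hmem y hyW
  · simp [hΨp]
  · intro v
    exact (hasFDerivAt_fst.comp_hasDerivAt (0 : ℝ) (hcurve' v)).deriv
  · intro v w
    have hc : ContDiffAt ℝ 2 (fun t : ℝ => (Ψ (q (t • v))).1) 0 := (hcurve v).fst
    have hl : ContDiffAt ℝ 2 (fun t : ℝ => (Ψ (q (t • v))).2) 0 := (hcurve v).snd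
    have hb : ContDiffAt ℝ 2 (fun t : ℝ => fderiv ℝ g (Ψ (q (t • v))).1 w) 0 :=
      (((hg.fderiv_right (m := ∞) (by simp)).of_le htwo).contDiffAt.comp (0 : ℝ) hc).clm_apply
        contDiffAt_const
    have hl' : deriv (fun t : ℝ => (Ψ (q (t • v))).2) 0 = 0 :=
      ((ContinuousLinearMap.snd ℝ (EuclideanSpace ℝ (Fin n))
        (EuclideanSpace ℝ (Fin m) →L[ℝ] ℝ)).hasFDerivAt.comp_hasDerivAt (0 : ℝ) (hcurve' v)).deriv
    have hpair := deriv_deriv_clm_apply_eq_zero hl hb (by simp [hΨp]) hl'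
      (by simpa [hΨp, ← hA] using hker w)
    have hinner : (fun t : ℝ => (Ψ (q (t • v))).2 (fderiv ℝ g (Ψ (q (t • v))).1 w)) =ᶠ[𝓝 0]
        fun t => ⟪p, (w : EuclideanSpace ℝ (Fin n))⟫
          + t * ⟪(v : EuclideanSpace ℝ (Fin n)), (w : EuclideanSpace ℝ (Fin n))⟫
          - ⟪(Ψ (q (t • v))).1, (w : EuclideanSpace ℝ (Fin n))⟫ := by
      have hlim : Tendsto (fun t : ℝ => t • v) (𝓝 0) (𝓝 0) := by
        simpa using (hray v).continuous.tendsto 0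
      filter_upwards [hlim.eventually hev] with t ht
      have h := DFunLike.congr_fun (congrArg Prod.fst ht.1.2) (w : EuclideanSpace ℝ (Fin n))
      simp only [lagrangeMap, q, add_apply, ContinuousLinearMap.comp_apply,
        innerSL_apply_apply, inner_add_left, Submodule.coe_smul, real_inner_smul_left] at h
      simp only [q, Submodule.coe_smul]
      linarith
    have hfirst : deriv (fun t : ℝ => (Ψ (q (t • v))).2 (fderiv ℝ g (Ψ (q (t • v))).1 w)) =ᶠ[𝓝 0]
        fun t => ⟪(v : EuclideanSpace ℝ (Fin n)), (w : EuclideanSpace ℝ (Fin n))⟫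
          - ⟪deriv (fun t : ℝ => (Ψ (q (t • v))).1) t, (w : EuclideanSpace ℝ (Fin n))⟫ := by
      refine hinner.deriv.trans ?_
      filter_upwards [hc.eventually (by simp)] with t ht
      have h := (((hasDerivAt_id t).mul_const
        ⟪(v : EuclideanSpace ℝ (Fin n)), (w : EuclideanSpace ℝ (Fin n))⟫).const_add
        ⟪p, (w : EuclideanSpace ℝ (Fin n))⟫).sub
        ((ht.differentiableAt (by simp)).hasDerivAt.inner ℝ
          (hasDerivAt_const t (w : EuclideanSpace ℝ (Fin n))))
      exact h.deriv.trans (by simp)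
    have hdd : DifferentiableAt ℝ (deriv fun t : ℝ => (Ψ (q (t • v))).1) 0 :=
      (hc.derivWithin (m := 1) (by norm_num)).differentiableAt (by simp)
    have hsecond := (hdd.hasDerivAt.inner ℝ
      (hasDerivAt_const (0 : ℝ) (w : EuclideanSpace ℝ (Fin n)))).const_sub
      ⟪(v : EuclideanSpace ℝ (Fin n)), (w : EuclideanSpace ℝ (Fin n))⟫
    rw [hfirst.deriv_eq, hsecond.deriv] at hpair
    simpa using hpair
end

section
/- Let C = {(x, y) ∈ ℝ² : y² = x³} be the cuspidal cubic and let γ : [0,1] → ℝ² be a curve with γ(t) ∈ C for all t ∈ [0,1], γ(1) = (0,0), and γ differentiable at t = 1 (one-sided derivative). Then the velocity γ'(1) lies in the ray ℝ_{≥0} · (−1, 0); in particular its second coordinate is 0 and its first coordinate is ≤ 0. -/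
/-- Let `C = {(x, y) : y² = x³}` be the cuspidal cubic and let
`γ : [0,1] → ℝ²` be a curve lying on `C` with `γ 1 = (0,0)` which has a one-sided
derivative `v` at `t = 1`. Then `v` lies in the ray `ℝ≥0 · (−1, 0)`; in particular
its second coordinate is `0` and its first coordinate is `≤ 0`. -/
theorem cusp_velocity_in_ray
    (γ : ℝ → ℝ × ℝ)
    (hC : ∀ t ∈ Set.Icc (0 : ℝ) 1, (γ t).2 ^ 2 = (γ t).1 ^ 3)
    (h1 : γ 1 = (0, 0))
    (v : ℝ × ℝ)
    (hv : HasDerivWithinAt γ v (Set.Icc (0 : ℝ) 1) 1) :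
    (∃ c : ℝ, 0 ≤ c ∧ v = c • ((-1 : ℝ), (0 : ℝ))) ∧ v.2 = 0 ∧ v.1 ≤ 0 := by
  have hslope := hasDerivWithinAt_iff_tendsto_slope.mp hv
  rw [Set.Icc_sdiff_right] at hslope
  have : (nhdsWithin (1 : ℝ) (Set.Ico 0 1)).NeBot := right_nhdsWithin_Ico_neBot zero_lt_one
  have hfst := (continuous_fst.tendsto v).comp hslope
  have hsnd := (continuous_snd.tendsto v).comp hslope
  have hv1 : v.1 ≤ 0 := by
    refine le_of_tendsto hfst ?_
    filter_upwards [self_mem_nhdsWithin] with t ht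
    have hx : 0 ≤ (γ t).1 := by
      have hodd : Odd 3 := by decide
      exact hodd.pow_nonneg_iff.mp (hC t ⟨ht.1, ht.2.le⟩ ▸ sq_nonneg _)
    simpa [slope, h1] using
      mul_nonpos_of_nonpos_of_nonneg (inv_nonpos.mpr (sub_nonpos.mpr ht.2.le)) hx
  have hv2 : v.2 = 0 := by
    have hsub : Filter.Tendsto (fun t : ℝ => t - 1) (nhdsWithin 1 (Set.Ico 0 1))
        (nhds (1 - 1)) :=
      ((continuous_id.sub continuous_const).tendsto 1).mono_left nhdsWithin_le_nhds
    have heq : v.2 ^ 2 = v.1 ^ 3 * (1 - 1) := by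
      refine tendsto_nhds_unique_of_eventuallyEq (hsnd.pow 2) ((hfst.pow 3).mul hsub) ?_
      filter_upwards [self_mem_nhdsWithin] with t ht
      have hne : t - 1 ≠ 0 := (sub_neg.mpr ht.2).ne
      have hcurve := hC t ⟨ht.1, ht.2.le⟩
      simp only [Function.comp_apply, slope, h1, vsub_eq_sub, Prod.smul_fst, Prod.smul_snd,
        Prod.fst_sub, Prod.snd_sub, sub_zero, smul_eq_mul, mul_pow, hcurve]
      field_simp
    simpa using heq
  exact ⟨⟨-v.1, neg_nonneg.mpr hv1, Prod.ext (by simp) (by simp [hv2])⟩, hv2, hv1⟩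
end
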